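/- arXiv:2003.07035 — 2 statements merged into one kernel-verified Lean document; each statement's English description precedes it below -/
import Mathlib

section
/- Let (R, I) be a graded pair of dimension d ≥ 2 and M a finitely generated graded R-module. Then the HK density function f_{M_R,I} exists, is a compactly supported continuous function on [0,∞), and satisfies f_{M_R,I} = rank_R(M) · f_{R,I}, where rank_R(M) = dim_{Q(R)}(M ⊗_R Q(R)) is the generic rank of M over the domain R and Q(R) is the quotient field of R. -/
open Filter MeasureTheory Topology

noncomputable section

/-- The `q`-th Frobenius bracket power `I^{[q]}` of an ideal `I`. -/
def Ideal.frobeniusPow {R : Type*} [CommSemiring R] (I : Ideal R) (q : ℕ) : Ideal R :=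
  Ideal.span ((· ^ q) '' (I : Set R))

/-- `dim_k` of the degree-`j` graded piece of `M ⧸ N`, for a graded `k`-module `M`
with grading `ℳ` and a `k`-submodule `N ≤ M`. -/
def gradedPieceLen (k : Type*) [Field k] {M : Type*} [AddCommGroup M] [Module k M]
    (ℳ : ℕ → Submodule k M) (N : Submodule k M) (j : ℕ) : ℕ :=
  Module.finrank k (↥(ℳ j) ⧸ (N.comap (ℳ j).subtype))

/-- The step function `f_n(M_R, I)` of a graded pair, for a graded module `M`. -/
def hkStep (k : Type*) [Field k] {R M : Type*} [CommRing R] [AddCommGroup M] [Module R M]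
    [Module k M] [SMul k R] [IsScalarTower k R M]
    (ℳ : ℕ → Submodule k M) (I : Ideal R) (d n₀ p n : ℕ) (x : ℝ) : ℝ :=
  (∑ i ∈ Finset.range n₀,
      (gradedPieceLen k ℳ ((I.frobeniusPow (p ^ n) • (⊤ : Submodule R M)).restrictScalars k)
        (⌊x * (p ^ n : ℕ)⌋₊ * n₀ + i) : ℝ)) / ((p : ℝ) ^ n) ^ (d - 1)

/-- The interpolated function `g_n(M_R, I)` of a graded pair. -/
def hkStepG (k : Type*) [Field k] {R M : Type*} [CommRing R] [AddCommGroup M] [Module R M]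
    [Module k M] [SMul k R] [IsScalarTower k R M]
    (ℳ : ℕ → Submodule k M) (I : Ideal R) (d n₀ p n : ℕ) (x : ℝ) : ℝ :=
  (1 - (x * (p ^ n : ℕ) - ⌊x * (p ^ n : ℕ)⌋₊)) *
      hkStep k ℳ I d n₀ p n ((⌊x * (p ^ n : ℕ)⌋₊ : ℝ) / (p ^ n : ℕ))
    + (x * (p ^ n : ℕ) - ⌊x * (p ^ n : ℕ)⌋₊) *
      hkStep k ℳ I d n₀ p n ((⌊x * (p ^ n : ℕ)⌋₊ + 1 : ℝ) / (p ^ n : ℕ))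

section RelDim

variable {k : Type*} [Field k]

/-- The dimension of `S ⧸ (S ⊓ W)`. -/
def relDim {M : Type*} [AddCommGroup M] [Module k M] (S W : Submodule k M) : ℕ :=
  Module.finrank k (S ⧸ W.comap S.subtype)

theorem finrank_quotient_le_add {X Z : Type*} [AddCommGroup X] [Module k X] [AddCommGroup Z]
    [Module k Z] [FiniteDimensional k X] [FiniteDimensional k Z] (W Y : Submodule k X)
    (f : Z →ₗ[k] X) (Z₀ : Submodule k Z) (hZ : Z₀ ≤ W.comap f)
    (hY : Y ≤ W ⊔ LinearMap.range f) :
    Module.finrank k (X ⧸ W) ≤ Module.finrank k (X ⧸ Y) + Module.finrank k (Z ⧸ Z₀) := by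
  set g : (Z ⧸ Z₀) →ₗ[k] (X ⧸ W) := Z₀.mapQ W f hZ with hg
  have h1 : Module.finrank k ((X ⧸ W) ⧸ LinearMap.range g) + Module.finrank k (LinearMap.range g)
      = Module.finrank k (X ⧸ W) := Submodule.finrank_quotient_add_finrank _
  have h2 : Module.finrank k (LinearMap.range g) ≤ Module.finrank k (Z ⧸ Z₀) :=
    LinearMap.finrank_range_le g
  have h3 : Module.finrank k ((X ⧸ W) ⧸ LinearMap.range g) ≤ Module.finrank k (X ⧸ Y) := by
    have hle : Y ≤ LinearMap.ker ((LinearMap.range g).mkQ ∘ₗ W.mkQ) := by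
      refine hY.trans (sup_le ?_ ?_)
      · intro x hx
        simp [(Submodule.Quotient.mk_eq_zero W).2 hx]
      · rintro _ ⟨z, rfl⟩
        simp only [LinearMap.mem_ker, LinearMap.comp_apply, Submodule.mkQ_apply,
          Submodule.Quotient.mk_eq_zero]
        exact ⟨Submodule.Quotient.mk z, rfl⟩
    refine LinearMap.finrank_le_finrank_of_surjective (f := Y.liftQ _ hle) ?_
    rw [← LinearMap.range_eq_top, Submodule.range_liftQ, LinearMap.range_eq_top]
    exact (Submodule.mkQ_surjective _).comp (Submodule.mkQ_surjective _)
  omega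

variable {M N E : Type*} [AddCommGroup M] [Module k M] [AddCommGroup N] [Module k N]
  [AddCommGroup E] [Module k E]

theorem relDim_le_add (S W Y : Submodule k M) (T T₀ : Submodule k N)
    [FiniteDimensional k S] [FiniteDimensional k T] (f : N →ₗ[k] M)
    (hf : ∀ z ∈ T, f z ∈ S) (h₀ : ∀ z ∈ T, z ∈ T₀ → f z ∈ W)
    (hY : ∀ y ∈ S, y ∈ Y → ∃ z ∈ T, y - f z ∈ W) :
    relDim S W ≤ relDim S Y + relDim T T₀ := by
  refine finrank_quotient_le_add _ _ (f.restrict hf) _ ?_ ?_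
  · intro z hz
    exact h₀ z z.2 hz
  · intro y hy
    obtain ⟨z, hz, hyz⟩ := hY y y.2 hy
    refine Submodule.mem_sup.2 ⟨y - f.restrict hf ⟨z, hz⟩, hyz, _, ⟨⟨z, hz⟩, rfl⟩, by simp⟩

theorem relDim_le_of_map (S W : Submodule k M) (T T₀ : Submodule k N)
    [FiniteDimensional k T] (f : M →ₗ[k] N)
    (hf : ∀ z ∈ S, f z ∈ T) (h₀ : ∀ z ∈ S, f z ∈ T₀ → z ∈ W) :
    relDim S W ≤ relDim T T₀ := by
  set g := (T₀.comap T.subtype).mkQ ∘ₗ f.restrict hf with hg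
  have hk : LinearMap.ker g ≤ W.comap S.subtype := by
    intro x hx
    have : f x ∈ T₀ := by simpa [hg] using hx
    exact h₀ x x.2 this
  have e := g.quotKerEquivRange
  have : FiniteDimensional k (S ⧸ LinearMap.ker g) := FiniteDimensional.of_injective
    e.toLinearMap e.injective
  calc relDim S W ≤ Module.finrank k (S ⧸ LinearMap.ker g) :=
        LinearMap.finrank_le_finrank_of_surjective (f := Submodule.factor hk)
          (Submodule.factor_surjective hk)
    _ = Module.finrank k (LinearMap.range g) := e.finrank_eq
    _ ≤ _ := Submodule.finrank_le _

theorem relDim_mono_right (S : Submodule k M) {W W' : Submodule k M} [FiniteDimensional k S]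
    (h : ∀ x ∈ S, x ∈ W → x ∈ W') : relDim S W' ≤ relDim S W :=
  relDim_le_of_map _ _ _ _ LinearMap.id (fun _ hz => hz) h

theorem relDim_eq_zero {S W : Submodule k M} (h : S ≤ W) : relDim S W = 0 := by
  have : W.comap S.subtype = ⊤ := by
    rw [eq_top_iff]; intro x _; exact h x.2
  have : Subsingleton (S ⧸ W.comap S.subtype) := by
    rw [this]; infer_instance
  exact Module.finrank_zero_of_subsingleton

theorem relDim_le_add_of_relation (S W : Submodule k M) (T T₀ : Submodule k N)
    (U U₀ : Submodule k E) [FiniteDimensional k S] [FiniteDimensional k T]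
    [FiniteDimensional k U] (f : M →ₗ[k] N) (g : E →ₗ[k] N)
    (hf : ∀ x ∈ S, f x ∈ T) (hg : ∀ x ∈ S, f x ∈ T₀ → ∃ e ∈ U, g e = f x)
    (h₀ : ∀ x ∈ S, ∀ e ∈ U, g e = f x → e ∈ U₀ → x ∈ W) :
    relDim S W ≤ relDim T T₀ + relDim U U₀ := by
  set P : Submodule k (M × E) := S.prod U ⊓
    LinearMap.ker (g ∘ₗ LinearMap.snd k M E - f ∘ₗ LinearMap.fst k M E) with hP
  have : FiniteDimensional k (S.prod U) :=
    Module.Finite.iff_fg.2 ((Module.Finite.iff_fg.1 ‹_›).prod (Module.Finite.iff_fg.1 ‹_›))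
  have : FiniteDimensional k P := Submodule.finiteDimensional_of_le inf_le_left
  have hmem : ∀ z ∈ P, z.1 ∈ S ∧ z.2 ∈ U ∧ g z.2 = f z.1 := by
    rintro z ⟨⟨h1, h2⟩, h3⟩
    exact ⟨h1, h2, by simpa [sub_eq_zero] using h3⟩
  have h1 : relDim S W ≤ relDim S (T₀.comap f) + relDim P (U₀.comap (LinearMap.snd k M E)) := by
    refine relDim_le_add _ _ _ _ _ (LinearMap.fst k M E) (fun z hz => (hmem z hz).1) ?_ ?_
    · intro z hz hz0
      exact h₀ _ (hmem z hz).1 _ (hmem z hz).2.1 (hmem z hz).2.2 hz0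
    · intro y hy hy0
      obtain ⟨e, he, hge⟩ := hg y hy hy0
      exact ⟨(y, e), ⟨⟨hy, he⟩, by simp [hge]⟩, by simp⟩
  have h2 : relDim S (T₀.comap f) ≤ relDim T T₀ :=
    relDim_le_of_map _ _ _ _ f hf (fun _ _ h => h)
  have h3 : relDim P (U₀.comap (LinearMap.snd k M E)) ≤ relDim U U₀ :=
    relDim_le_of_map _ _ _ _ (LinearMap.snd k M E) (fun z hz => (hmem z hz).2.1) (fun _ _ h => h)
  omega

theorem relDim_pi {ι : Type*} [Fintype ι] {V : ι → Type*} [∀ i, AddCommGroup (V i)]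
    [∀ i, Module k (V i)] (T T₀ : ∀ i, Submodule k (V i)) [∀ i, FiniteDimensional k (T i)] :
    relDim (Submodule.pi Set.univ T) (Submodule.pi Set.univ T₀) = ∑ i, relDim (T i) (T₀ i) := by
  let φ : Submodule.pi Set.univ T →ₗ[k] ∀ i, (T i ⧸ (T₀ i).comap (T i).subtype) :=
    LinearMap.pi fun i => ((T₀ i).comap (T i).subtype).mkQ ∘ₗ
      (LinearMap.proj i).restrict (fun x hx => hx i (Set.mem_univ i))
  have hker : LinearMap.ker φ =
      (Submodule.pi Set.univ T₀).comap (Submodule.pi Set.univ T).subtype := by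
    ext x
    simp only [φ, LinearMap.mem_ker, LinearMap.pi_apply, funext_iff, LinearMap.comp_apply,
      Pi.zero_apply, Submodule.mkQ_apply, Submodule.Quotient.mk_eq_zero, Submodule.mem_comap,
      Submodule.mem_pi, Set.mem_univ, forall_const, Submodule.subtype_apply]
    rfl
  have hsurj : Function.Surjective φ := by
    intro y
    choose z hz using fun i => Submodule.mkQ_surjective _ (y i)
    exact ⟨⟨fun i => z i, fun i _ => (z i).2⟩, funext fun i => hz i⟩
  have e := φ.quotKerEquivOfSurjective hsurj
  rw [relDim, ← hker, e.finrank_eq, Module.finrank_pi_fintype]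
  rfl

theorem finiteDimensional_pi {ι : Type*} [Finite ι] {V : ι → Type*} [∀ i, AddCommGroup (V i)]
    [∀ i, Module k (V i)] (T : ∀ i, Submodule k (V i)) [∀ i, FiniteDimensional k (T i)] :
    FiniteDimensional k (Submodule.pi Set.univ T) :=
  Module.Finite.iff_fg.2 (Submodule.fg_pi fun _ => Module.Finite.iff_fg.1 inferInstance)

end RelDim

section Graded

variable {k : Type*} [Field k] {R : Type*} [CommRing R] [Algebra k R]
  (𝒜 : ℕ → Submodule k R)

/-- The pieces of `R` with degrees scaled by `w` and then shifted by `b`. -/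
def shiftPiece (w b j : ℕ) : Submodule k R :=
  if b ≤ j ∧ w ∣ j - b then 𝒜 ((j - b) / w) else ⊥

theorem shiftPiece_add {w : ℕ} (hw : 0 < w) (b a : ℕ) :
    shiftPiece 𝒜 w b (w * a + b) = 𝒜 a := by
  rw [shiftPiece, if_pos ⟨by omega, by simp⟩]
  congr 1
  rw [Nat.add_sub_cancel, Nat.mul_div_cancel_left _ hw]

theorem shiftPiece_eq_bot {w b j : ℕ} (h : ∀ a, j ≠ w * a + b) : shiftPiece 𝒜 w b j = ⊥ := by
  rw [shiftPiece, if_neg]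
  rintro ⟨h1, a, ha⟩
  exact h a (by omega)

theorem shiftPiece_cases {w : ℕ} (hw : 0 < w) (b j : ℕ) :
    (∃ a, j = w * a + b ∧ shiftPiece 𝒜 w b j = 𝒜 a) ∨
      ((∀ a, j ≠ w * a + b) ∧ shiftPiece 𝒜 w b j = ⊥) := by
  by_cases h : ∃ a, j = w * a + b
  · obtain ⟨a, rfl⟩ := h
    exact Or.inl ⟨a, rfl, shiftPiece_add 𝒜 hw b a⟩
  · push Not at h
    exact Or.inr ⟨h, shiftPiece_eq_bot 𝒜 h⟩

theorem finiteDimensional_shiftPiece [∀ j, FiniteDimensional k (𝒜 j)] (w b j : ℕ) :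
    FiniteDimensional k (shiftPiece 𝒜 w b j) := by
  by_cases h : b ≤ j ∧ w ∣ j - b
  · rw [shiftPiece, if_pos h]
    infer_instance
  · rw [shiftPiece, if_neg h]
    infer_instance

theorem shiftPiece_smul_mem {M : Type*} [AddCommGroup M] [Module R M]
    [Module k M] (ℳ : ℕ → Submodule k M) {w : ℕ} (hw : 0 < w)
    (hsm : ∀ a j, ∀ r ∈ 𝒜 a, ∀ m ∈ ℳ j, r • m ∈ ℳ (w * a + j)) {b j : ℕ} {m : M}
    (hm : m ∈ ℳ b) {r : R} (hr : r ∈ shiftPiece 𝒜 w b j) : r • m ∈ ℳ j := by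
  obtain ⟨a, rfl, h⟩ | ⟨-, h⟩ := shiftPiece_cases 𝒜 hw b j
  · exact hsm _ _ _ (h ▸ hr) _ hm
  · rw [h, Submodule.mem_bot] at hr
    simp [hr]

variable [GradedAlgebra 𝒜]

/-- The projection of `R` onto `shiftPiece 𝒜 w b j`. -/
def shiftProj (w b j : ℕ) (r : R) : R :=
  if b ≤ j ∧ w ∣ j - b then (DirectSum.decompose 𝒜 r ((j - b) / w) : R) else 0

theorem shiftProj_mem (w b j : ℕ) (r : R) : shiftProj 𝒜 w b j r ∈ shiftPiece 𝒜 w b j := by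
  rw [shiftProj, shiftPiece]
  split_ifs
  · exact SetLike.coe_mem _
  · exact zero_mem _

theorem shiftProj_add_degree {w : ℕ} (hw : 0 < w) (b a : ℕ) (r : R) :
    shiftProj 𝒜 w b (w * a + b) r = DirectSum.decompose 𝒜 r a := by
  rw [shiftProj, if_pos ⟨by omega, by simp⟩, Nat.add_sub_cancel, Nat.mul_div_cancel_left _ hw]

theorem shiftProj_eq_zero {w b j : ℕ} (h : ∀ a, j ≠ w * a + b) (r : R) :
    shiftProj 𝒜 w b j r = 0 := by
  rw [shiftProj, if_neg]
  rintro ⟨h1, a, ha⟩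
  exact h a (by omega)

variable {M : Type*} [AddCommGroup M] [Module R M] [Module k M]
  (ℳ : ℕ → Submodule k M) [DirectSum.Decomposition ℳ]

theorem decompose_smul_eq_shiftProj {w : ℕ} (hw : 0 < w)
    (hsm : ∀ a j, ∀ r ∈ 𝒜 a, ∀ m ∈ ℳ j, r • m ∈ ℳ (w * a + j)) {b : ℕ} {m : M} (hm : m ∈ ℳ b)
    (r : R) (j : ℕ) :
    (DirectSum.decompose ℳ (r • m) j : M) = shiftProj 𝒜 w b j r • m := by
  classical
  induction r using DirectSum.Decomposition.inductionOn 𝒜 with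
  | zero => simp [shiftProj]
  | homogeneous x =>
    rename_i a
    have hx := hsm a b x x.2 m hm
    by_cases h : w * a + b = j
    · subst h
      rw [DirectSum.decompose_of_mem_same ℳ hx, shiftProj_add_degree 𝒜 hw]
      simp
    · rw [DirectSum.decompose_of_mem_ne ℳ hx h]
      by_cases h' : ∃ c, j = w * c + b
      · obtain ⟨c, rfl⟩ := h'
        rw [shiftProj_add_degree 𝒜 hw, DirectSum.decompose_of_mem_ne 𝒜 x.2, zero_smul]
        rintro rfl
        exact h rfl
      · push Not at h'
        rw [shiftProj_eq_zero 𝒜 h', zero_smul]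
  | add x y hx hy =>
    rw [add_smul, DirectSum.decompose_add, DirectSum.add_apply, Submodule.coe_add, hx, hy,
      ← add_smul]
    congr 1
    simp only [shiftProj]
    split_ifs <;> simp

theorem exists_sum_shiftPiece {w : ℕ} (hw : 0 < w)
    (hsm : ∀ a j, ∀ r ∈ 𝒜 a, ∀ m ∈ ℳ j, r • m ∈ ℳ (w * a + j)) {ι : Type*} [Fintype ι]
    {b : ι → ℕ} {v : ι → M} (hv : ∀ i, v i ∈ ℳ (b i)) {j : ℕ} {x : M} (hx : x ∈ ℳ j)
    (r : ι → R) (hr : ∑ i, r i • v i = x) :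
    ∑ i, shiftProj 𝒜 w (b i) j (r i) • v i = x := by
  rw [← DirectSum.decompose_of_mem_same ℳ hx, ← hr, DirectSum.decompose_sum]
  rw [DFinsupp.finsetSum_apply, AddSubmonoidClass.coe_finsetSum]
  exact Finset.sum_congr rfl fun i _ => (decompose_smul_eq_shiftProj 𝒜 ℳ hw hsm (hv i) _ _).symm

theorem mul_mem_weighted (a j : ℕ) (r : R) (hr : r ∈ 𝒜 a) (m : R) (hm : m ∈ 𝒜 j) :
    r • m ∈ 𝒜 (1 * a + j) := by
  rw [one_mul]
  exact SetLike.mul_mem_graded hr hm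

theorem finiteDimensional_piece [IsNoetherianRing R] (h𝒜0 : 𝒜 0 ≤ Submodule.span k {1}) (j : ℕ) :
    FiniteDimensional k (𝒜 j) := by
  let Φ : Submodule k (𝒜 j) → Ideal R := fun W => Ideal.span ((↑) '' (W : Set (𝒜 j)))
  have key : ∀ (W : Submodule k (𝒜 j)) (x : 𝒜 j), (x : R) ∈ Φ W → x ∈ W := by
    intro W x hx
    obtain ⟨n, f, g, hfg⟩ := (Submodule.mem_span_set' (R := R)).1 hx
    choose y hyW hy using fun i => (g i).2
    have h := exists_sum_shiftPiece 𝒜 𝒜 one_pos (mul_mem_weighted 𝒜) (b := fun _ => j)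
      (v := fun i => (g i : R)) (fun i => by rw [← hy]; exact (y i).2) x.2 f hfg
    have h2 : ∀ i, ∃ c : k, shiftProj 𝒜 1 j j (f i) • (g i : R) = ((c • y i : 𝒜 j) : R) := by
      intro i
      have h3 := h𝒜0 (SetLike.coe_mem (DirectSum.decompose 𝒜 (f i) 0))
      obtain ⟨c, hc⟩ := Submodule.mem_span_singleton.1 h3
      refine ⟨c, ?_⟩
      have := shiftProj_add_degree 𝒜 one_pos j 0 (f i)
      simp only [mul_zero, zero_add] at this
      rw [this, ← hc, ← hy]
      simp
    choose c hc using h2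
    have : x = ∑ i, c i • y i := by
      apply Subtype.ext
      rw [← h, AddSubmonoidClass.coe_finsetSum]
      exact Finset.sum_congr rfl fun i _ => hc i
    rw [this]
    exact sum_mem fun i _ => W.smul_mem _ (hyW i)
  have hmono : StrictMono Φ := by
    refine (Monotone.strictMono_of_injective ?_ ?_)
    · intro W W' h
      exact Ideal.span_mono (Set.image_mono h)
    · intro W W' h
      ext x
      exact ⟨fun hx => key _ _ (h ▸ Ideal.subset_span ⟨x, hx, rfl⟩),
        fun hx => key _ _ (h.symm ▸ Ideal.subset_span ⟨x, hx, rfl⟩)⟩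
  have : WellFoundedGT (Submodule k (𝒜 j)) := hmono.wellFoundedGT
  have : IsNoetherian k (𝒜 j) := isNoetherian_iff'.2 this
  infer_instance

theorem finiteDimensional_modulePiece [IsScalarTower k R M] [∀ j, FiniteDimensional k (𝒜 j)]
    {w : ℕ} (hw : 0 < w)
    (hsm : ∀ a j, ∀ r ∈ 𝒜 a, ∀ m ∈ ℳ j, r • m ∈ ℳ (w * a + j)) {ι : Type*} [Fintype ι]
    {b : ι → ℕ} {v : ι → M} (hv : ∀ i, v i ∈ ℳ (b i))
    (hspan : Submodule.span R (Set.range v) = ⊤) (j : ℕ) : FiniteDimensional k (ℳ j) := by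
  have := fun i => finiteDimensional_shiftPiece 𝒜 w (b i) j
  have := finiteDimensional_pi fun i => shiftPiece 𝒜 w (b i) j
  refine Submodule.finiteDimensional_of_le (S₂ := (Submodule.pi Set.univ
    fun i => shiftPiece 𝒜 w (b i) j).map ((Fintype.linearCombination R v).restrictScalars k)) ?_
  intro x hx
  have hx' : x ∈ Submodule.span R (Set.range v) := hspan ▸ Submodule.mem_top
  obtain ⟨r, hr⟩ := (Submodule.mem_span_range_iff_exists_fun R).1 hx'
  exact ⟨_, fun i _ => shiftProj_mem 𝒜 w (b i) j (r i),
    exists_sum_shiftPiece 𝒜 ℳ hw hsm hv hx r hr⟩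

end Graded

/-- Growth of order at most `e - 1`, with growth of order at most `-1` meaning eventually zero. -/
def PolyBound : ℕ → (ℕ → ℕ) → Prop
  | 0, h => ∃ N, ∀ j ≥ N, h j = 0
  | e + 1, h => ∃ C, ∀ j, h j ≤ C * (j + 1) ^ e

namespace PolyBound

theorem mono {e : ℕ} {g h : ℕ → ℕ} (hg : PolyBound e g) (hgh : ∀ j, h j ≤ g j) :
    PolyBound e h := by
  cases e with
  | zero =>
    obtain ⟨N, hN⟩ := hg
    exact ⟨N, fun j hj => Nat.le_zero.1 (hN j hj ▸ hgh j)⟩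
  | succ e =>
    obtain ⟨C, hC⟩ := hg
    exact ⟨C, fun j => (hgh j).trans (hC j)⟩

theorem add {e : ℕ} {g h : ℕ → ℕ} (hg : PolyBound e g) (hh : PolyBound e h) :
    PolyBound e (fun j => g j + h j) := by
  cases e with
  | zero =>
    obtain ⟨N, hN⟩ := hg
    obtain ⟨N', hN'⟩ := hh
    refine ⟨max N N', fun j hj => ?_⟩
    simp only
    rw [hN j (le_trans (le_max_left _ _) hj), hN' j (le_trans (le_max_right _ _) hj)]
  | succ e =>
    obtain ⟨C, hC⟩ := hg
    obtain ⟨C', hC'⟩ := hh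
    refine ⟨C + C', fun j => ?_⟩
    rw [add_mul]
    exact add_le_add (hC j) (hC' j)

theorem shift {e : ℕ} {h : ℕ → ℕ} (hh : PolyBound e h) (a : ℕ) :
    PolyBound e (fun j => if a ≤ j then h (j - a) else 0) := by
  cases e with
  | zero =>
    obtain ⟨N, hN⟩ := hh
    refine ⟨N + a, fun j hj => ?_⟩
    simp only
    rw [if_pos (by omega), hN _ (by omega)]
  | succ e =>
    obtain ⟨C, hC⟩ := hh
    refine ⟨C, fun j => ?_⟩
    simp only
    split_ifs
    · refine (hC _).trans ?_
      gcongr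
      omega
    · exact Nat.zero_le _

theorem of_zero {h : ℕ → ℕ} (hh : PolyBound 0 h) (e : ℕ) : PolyBound e h := by
  cases e with
  | zero => exact hh
  | succ e =>
    obtain ⟨N, hN⟩ := hh
    refine ⟨∑ i ∈ Finset.range N, h i, fun j => ?_⟩
    by_cases hj : j < N
    · calc h j ≤ ∑ i ∈ Finset.range N, h i :=
            Finset.single_le_sum (fun _ _ => Nat.zero_le _) (Finset.mem_range.2 hj)
        _ ≤ _ := Nat.le_mul_of_pos_right _ (by positivity)
    · rw [hN j (by omega)]
      exact Nat.zero_le _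

theorem succ_of_step {e a : ℕ} {g h : ℕ → ℕ} (ha : 0 < a) (hg : PolyBound e g)
    (hstep : ∀ j, h (j + a) ≤ h j + g (j + a)) : PolyBound (e + 1) h := by
  cases e with
  | zero =>
    obtain ⟨N, hN⟩ := hg
    refine ⟨∑ i ∈ Finset.range (N + a), h i, fun j => ?_⟩
    rw [pow_zero, mul_one]
    induction j using Nat.strong_induction_on with
    | _ j ih =>
      by_cases hj : j < N + a
      · exact Finset.single_le_sum (fun _ _ => Nat.zero_le _) (Finset.mem_range.2 hj)
      · have h1 := hstep (j - a)
        rw [Nat.sub_add_cancel (by omega), hN j (by omega)] at h1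
        exact h1.trans (ih _ (by omega))
  | succ e =>
    obtain ⟨C, hC⟩ := hg
    refine ⟨C + ∑ i ∈ Finset.range a, h i, fun j => ?_⟩
    induction j using Nat.strong_induction_on with
    | _ j ih =>
      by_cases hj : j < a
      · calc h j ≤ ∑ i ∈ Finset.range a, h i :=
              Finset.single_le_sum (fun _ _ => Nat.zero_le _) (Finset.mem_range.2 hj)
          _ ≤ _ := Nat.le_add_left _ _
          _ ≤ _ := Nat.le_mul_of_pos_right _ (by positivity)
      · obtain ⟨i, rfl⟩ : ∃ i, j = i + a := ⟨j - a, by omega⟩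
        set D := C + ∑ i ∈ Finset.range a, h i
        have hCD : C ≤ D := Nat.le_add_right _ _
        calc h (i + a) ≤ h i + g (i + a) := hstep i
          _ ≤ D * (i + 1) ^ (e + 1) + D * (i + a + 1) ^ e :=
            add_le_add (ih i (by omega)) ((hC _).trans (by gcongr))
          _ = D * ((i + 1) ^ e * (i + 1) + (i + a + 1) ^ e) := by ring
          _ ≤ D * ((i + a + 1) ^ e * (i + 1) + (i + a + 1) ^ e) := by gcongr; omega
          _ = D * ((i + a + 1) ^ e * (i + 1 + 1)) := by ring
          _ ≤ D * ((i + a + 1) ^ e * (i + a + 1)) := by gcongr; omega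
          _ = _ := by ring

end PolyBound

section Hilbert

variable {k : Type*} [Field k] {R : Type*} [CommRing R] [Algebra k R]
  (𝒜 : ℕ → Submodule k R)

theorem relDim_shiftPiece_one (J : Submodule k R) (b j : ℕ) :
    relDim (shiftPiece 𝒜 1 b j) J = if b ≤ j then relDim (𝒜 (j - b)) J else 0 := by
  split_ifs with h
  · obtain ⟨a, rfl⟩ : ∃ a, j = 1 * a + b := ⟨j - b, by omega⟩
    rw [shiftPiece_add 𝒜 one_pos]
    congr 2
    omega
  · rw [shiftPiece_eq_bot 𝒜 (by intro a; omega)]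
    exact relDim_eq_zero bot_le

variable [GradedAlgebra 𝒜]

theorem shiftProj_mul {b : ℕ} {a : R} (ha : a ∈ 𝒜 b) (r : R) (j : ℕ) :
    (DirectSum.decompose 𝒜 (r * a) j : R) = shiftProj 𝒜 1 b j r * a :=
  decompose_smul_eq_shiftProj 𝒜 𝒜 one_pos (mul_mem_weighted 𝒜) ha r j

theorem relDim_le_sup_span [∀ j, FiniteDimensional k (𝒜 j)] {J J' : Ideal R}
    (hJ : J.IsHomogeneous 𝒜) {b : ℕ} {a : R} (ha : a ∈ 𝒜 b) (hJ' : ∀ r ∈ J', r * a ∈ J) (j : ℕ) :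
    relDim (𝒜 j) (J.restrictScalars k) ≤
      relDim (𝒜 j) ((J ⊔ Ideal.span {a}).restrictScalars k) +
        if b ≤ j then relDim (𝒜 (j - b)) (J'.restrictScalars k) else 0 := by
  rw [← relDim_shiftPiece_one]
  have := finiteDimensional_shiftPiece 𝒜 1 b j
  refine relDim_le_add _ _ _ _ _ (LinearMap.mulRight k a) ?_ ?_ ?_
  · intro z hz
    exact shiftPiece_smul_mem 𝒜 𝒜 one_pos (mul_mem_weighted 𝒜) ha hz
  · intro z _ hz
    exact hJ' z hz
  · intro y hy hyJ
    obtain ⟨u, hu, v, hv, rfl⟩ := Submodule.mem_sup.1 hyJ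
    obtain ⟨r, rfl⟩ := Ideal.mem_span_singleton'.1 hv
    refine ⟨shiftProj 𝒜 1 b j r, shiftProj_mem 𝒜 _ _ _ _, ?_⟩
    have h1 := DirectSum.decompose_of_mem_same 𝒜 hy
    rw [DirectSum.decompose_add, DirectSum.add_apply, Submodule.coe_add, shiftProj_mul 𝒜 ha] at h1
    have h2 : u + r * a - shiftProj 𝒜 1 b j r * a = DirectSum.decompose 𝒜 u j := by
      rw [← h1]; ring
    rw [LinearMap.mulRight_apply, h2]
    exact hJ j hu

theorem isHomogeneous_sup_span {J : Ideal R} (hJ : J.IsHomogeneous 𝒜) {b : ℕ} {a : R}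
    (ha : a ∈ 𝒜 b) : (J ⊔ Ideal.span {a}).IsHomogeneous 𝒜 :=
  hJ.sup (Ideal.homogeneous_span 𝒜 _ (by rintro x rfl; exact ⟨b, ha⟩))

theorem ringKrullDim_quotient_anti {I J : Ideal R} (h : I ≤ J) :
    ringKrullDim (R ⧸ J) ≤ ringKrullDim (R ⧸ I) :=
  ringKrullDim_le_of_surjective (Ideal.Quotient.factor h) (Ideal.Quotient.factor_surjective h)

theorem polyBound_relDim [IsNoetherianRing R] [∀ j, FiniteDimensional k (𝒜 j)] (J : Ideal R)
    (hJ : J.IsHomogeneous 𝒜) (e : ℕ) (he : ringKrullDim (R ⧸ J) ≤ e) :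
    PolyBound e (fun j => relDim (𝒜 j) (J.restrictScalars k)) := by
  induction J using WellFoundedGT.induction generalizing e with
  | ind J ih =>
  by_cases htop : J = ⊤
  · refine PolyBound.of_zero ⟨0, fun j _ => relDim_eq_zero ?_⟩ e
    subst htop
    exact fun _ _ => trivial
  have hlt : ∀ {a : R}, a ∉ J → J < J ⊔ Ideal.span {a} := fun {a} ha =>
    lt_of_le_of_ne le_sup_left fun h =>
      ha (h ▸ Ideal.mem_sup_right (Ideal.mem_span_singleton_self a))
  by_cases hprime : J.IsPrime
  · by_cases hs : ∃ b > 0, ∃ s ∈ 𝒜 b, s ∉ J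
    · obtain ⟨b, hb, s, hs, hsJ⟩ := hs
      have hdim : ringKrullDim (R ⧸ (J ⊔ Ideal.span {s})) + 1 ≤ ringKrullDim (R ⧸ J) := by
        refine ringKrullDim_succ_le_of_surjective (Ideal.Quotient.factor le_sup_left)
          (Ideal.Quotient.factor_surjective le_sup_left) (r := Ideal.Quotient.mk J s) ?_ ?_
        · rw [mem_nonZeroDivisors_iff_ne_zero]
          rwa [Ne, Ideal.Quotient.eq_zero_iff_mem]
        · rw [Ideal.Quotient.factor_mk, Ideal.Quotient.eq_zero_iff_mem]
          exact Ideal.mem_sup_right (Ideal.mem_span_singleton_self s)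
      replace hdim := hdim.trans he
      cases e with
      | zero =>
        exfalso
        have h1 : ringKrullDim (R ⧸ (J ⊔ Ideal.span {s})) = ⊥ :=
          (ENat.WithBot.add_one_le_zero_iff _).1 (by exact_mod_cast hdim)
        have hsub : Subsingleton (R ⧸ (J ⊔ Ideal.span {s})) := by
          by_contra hns
          rw [not_subsingleton_iff_nontrivial] at hns
          exact absurd (h1 ▸ ringKrullDim_nonneg_of_nontrivial) (by simp)
        have h2 : (1 : R) ∈ J ⊔ Ideal.span {s} :=
          Ideal.Quotient.subsingleton_iff.1 hsub ▸ Submodule.mem_top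
        obtain ⟨u, hu, v, hv, huv⟩ := Submodule.mem_sup.1 h2
        obtain ⟨r, rfl⟩ := Ideal.mem_span_singleton'.1 hv
        have h3 := DirectSum.decompose_of_mem_same 𝒜 (SetLike.one_mem_graded 𝒜)
        rw [← huv, DirectSum.decompose_add, DirectSum.add_apply, Submodule.coe_add,
          shiftProj_mul 𝒜 hs, shiftProj_eq_zero 𝒜 (by intro a; omega), zero_mul, add_zero,
          huv] at h3
        exact htop ((Ideal.eq_top_iff_one J).2 (h3 ▸ hJ 0 hu))
      | succ e =>
        have hdim' : ringKrullDim (R ⧸ (J ⊔ Ideal.span {s})) ≤ e :=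
          ENat.WithBot.add_le_add_one_right_iff.1 (by exact_mod_cast hdim)
        refine PolyBound.succ_of_step hb
          (ih _ (hlt hsJ) (isHomogeneous_sup_span 𝒜 hJ hs) e hdim') fun j => ?_
        have := relDim_le_sup_span 𝒜 hJ hs (J' := J) (fun r hr => J.mul_mem_right _ hr) (j + b)
        rw [if_pos (by omega), Nat.add_sub_cancel] at this
        exact this.trans (by rw [add_comm])
    · push Not at hs
      exact PolyBound.of_zero ⟨1, fun j hj => relDim_eq_zero (hs j hj)⟩ e
  · have : ∃ x y : R, SetLike.IsHomogeneousElem 𝒜 x ∧ SetLike.IsHomogeneousElem 𝒜 y ∧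
        x * y ∈ J ∧ x ∉ J ∧ y ∉ J := by
      by_contra hcon
      push Not at hcon
      refine hprime (hJ.isPrime_of_homogeneous_mem_or_mem htop fun {x y} hx hy hxy => ?_)
      by_contra! h
      exact h.2 (hcon x y hx hy hxy h.1)
    obtain ⟨x, y, ⟨b, hx⟩, ⟨c, hy⟩, hxy, hxJ, hyJ⟩ := this
    let J' : Ideal R := Submodule.comap (LinearMap.mulRight R x) J
    have hle : J ≤ J' := fun r hr => J.mul_mem_right _ hr
    have hJ' : J'.IsHomogeneous 𝒜 := by
      intro i r hr
      have h1 := hJ (1 * i + b) (show r * x ∈ J from hr)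
      rw [shiftProj_mul 𝒜 hx, shiftProj_add_degree 𝒜 one_pos] at h1
      exact h1
    have hltJ' : J < J' := lt_of_le_of_ne hle fun h => hyJ (by
      rw [h]
      show y * x ∈ J
      rwa [mul_comm])
    have h1 := ih _ (hlt hxJ) (isHomogeneous_sup_span 𝒜 hJ hx) e
      ((ringKrullDim_quotient_anti le_sup_left).trans he)
    have h2 := ih _ hltJ' hJ' e ((ringKrullDim_quotient_anti hle).trans he)
    exact (h1.add (h2.shift b)).mono fun j =>
      relDim_le_sup_span 𝒜 hJ hx (J' := J') (fun r hr => hr) j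

end Hilbert

/-- Growth of order at most `e` in `j`, uniformly in `n`. -/
def UnifBound (e : ℕ) (f : ℕ → ℕ → ℝ) : Prop := ∃ C, 0 ≤ C ∧ ∀ n j, |f n j| ≤ C * ((j : ℝ) + 1) ^ e

namespace UnifBound

variable {e : ℕ} {f g : ℕ → ℕ → ℝ}

theorem mono (hg : UnifBound e g) (h : ∀ n j, |f n j| ≤ g n j) : UnifBound e f := by
  obtain ⟨C, hC, hgC⟩ := hg
  exact ⟨C, hC, fun n j => (h n j).trans ((le_abs_self _).trans (hgC n j))⟩

theorem congr (hg : UnifBound e g) (h : ∀ n j, f n j = g n j) : UnifBound e f := by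
  rwa [funext fun n => funext (h n)]

theorem abs (hf : UnifBound e f) : UnifBound e (fun n j => |f n j|) := by
  obtain ⟨C, hC, hfC⟩ := hf
  exact ⟨C, hC, fun n j => by simpa using hfC n j⟩

theorem add (hf : UnifBound e f) (hg : UnifBound e g) :
    UnifBound e (fun n j => f n j + g n j) := by
  obtain ⟨C, hC, hfC⟩ := hf
  obtain ⟨D, hD, hgD⟩ := hg
  refine ⟨C + D, by positivity, fun n j => (abs_add_le _ _).trans ?_⟩
  rw [add_mul]
  exact add_le_add (hfC n j) (hgD n j)

theorem neg (hf : UnifBound e f) : UnifBound e (fun n j => - f n j) := by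
  obtain ⟨C, hC, hfC⟩ := hf
  exact ⟨C, hC, fun n j => by simpa using hfC n j⟩

theorem sub (hf : UnifBound e f) (hg : UnifBound e g) :
    UnifBound e (fun n j => f n j - g n j) := by
  simpa only [sub_eq_add_neg] using hf.add hg.neg

theorem zero : UnifBound e (fun _ _ => 0) := ⟨0, le_rfl, by simp⟩

theorem sum {ι : Type*} {F : ι → ℕ → ℕ → ℝ} (s : Finset ι) (h : ∀ i ∈ s, UnifBound e (F i)) :
    UnifBound e (fun n j => ∑ i ∈ s, F i n j) := by
  classical
  induction s using Finset.induction_on with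
  | empty => simpa using zero
  | insert a s ha ih =>
    simp only [Finset.sum_insert ha]
    exact (h a (Finset.mem_insert_self _ _)).add
      (ih fun i hi => h i (Finset.mem_insert_of_mem hi))

theorem comp (hf : UnifBound e f) (a b c : ℕ) : UnifBound e (fun n j => f (n + c) (a * j + b)) := by
  obtain ⟨C, hC, hfC⟩ := hf
  refine ⟨C * ((a : ℝ) + b + 1) ^ e, by positivity, fun n j => (hfC _ _).trans ?_⟩
  rw [mul_assoc, ← mul_pow]
  gcongr
  push_cast
  nlinarith [(Nat.cast_nonneg a : (0 : ℝ) ≤ a), (Nat.cast_nonneg b : (0 : ℝ) ≤ b),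
    (Nat.cast_nonneg j : (0 : ℝ) ≤ j),
    mul_nonneg (Nat.cast_nonneg b : (0 : ℝ) ≤ b) (Nat.cast_nonneg j : (0 : ℝ) ≤ j)]

theorem of_le_between {u v : ℕ → ℕ → ℝ} (hf : UnifBound e f) (hg : UnifBound e g)
    (h1 : ∀ n j, u n j ≤ v n j + f n j) (h2 : ∀ n j, v n j ≤ u n j + g n j) :
    UnifBound e (fun n j => u n j - v n j) := by
  refine (hf.abs.add hg.abs).mono fun n j => ?_
  rw [abs_le]
  constructor <;> linarith [h1 n j, h2 n j, le_abs_self (f n j), le_abs_self (g n j),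
    abs_nonneg (f n j), abs_nonneg (g n j)]

end UnifBound

theorem PolyBound.unifBound {e : ℕ} {h : ℕ → ℕ} (hh : PolyBound (e + 1) h) {f : ℕ → ℕ → ℕ}
    (hf : ∀ n j, ∃ i ≤ j, f n j ≤ h i) : UnifBound e (fun n j => (f n j : ℝ)) := by
  obtain ⟨C, hC⟩ := hh
  refine ⟨C, by positivity, fun n j => ?_⟩
  obtain ⟨i, hi, hfi⟩ := hf n j
  have : f n j ≤ C * (j + 1) ^ e := hfi.trans ((hC i).trans (by gcongr))
  rw [abs_of_nonneg (by positivity)]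
  show (f n j : ℝ) ≤ C * ((j : ℝ) + 1) ^ e
  exact_mod_cast this

section Estimates

variable {k : Type*} [Field k] {R : Type*} [CommRing R] [Algebra k R]
  (𝒜 : ℕ → Submodule k R)

theorem exists_relDim_shiftPiece_le {w : ℕ} (hw : 0 < w) (J : Submodule k R) (b j : ℕ) :
    ∃ i ≤ j, relDim (shiftPiece 𝒜 w b j) J ≤ relDim (𝒜 i) J := by
  obtain ⟨a, rfl, h⟩ | ⟨-, h⟩ := shiftPiece_cases 𝒜 hw b j
  · exact ⟨a, by nlinarith, by rw [h]⟩
  · exact ⟨0, Nat.zero_le _, by rw [h, relDim_eq_zero bot_le]; exact Nat.zero_le _⟩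

variable [GradedAlgebra 𝒜]

theorem relDim_le_of_mul_injective [IsDomain R] [∀ j, FiniteDimensional k (𝒜 j)] {ι : Type*}
    [Fintype ι] {g : ι → R} {γ : ι → ℕ} (hg : ∀ i, g i ∈ 𝒜 (γ i)) {a : ℕ} {s : R}
    (hs : s ∈ 𝒜 a) (hs0 : s ≠ 0) (j : ℕ) :
    relDim (𝒜 j) ((Ideal.span (Set.range g)).restrictScalars k) ≤
      relDim (𝒜 (j + a)) ((Ideal.span (Set.range g)).restrictScalars k) +
        ∑ i, relDim (shiftPiece 𝒜 1 (γ i) (j + a)) ((Ideal.span {s}).restrictScalars k) := by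
  have := fun i => finiteDimensional_shiftPiece 𝒜 1 (γ i) (j + a)
  have := finiteDimensional_pi fun i => shiftPiece 𝒜 1 (γ i) (j + a)
  rw [← relDim_pi]
  refine relDim_le_add_of_relation _ _ _ _ _ _ (LinearMap.mulRight k s)
    ((Fintype.linearCombination R g).restrictScalars k) ?_ ?_ ?_
  · exact fun x hx => SetLike.mul_mem_graded hx hs
  · intro x hx hxs
    obtain ⟨r, hr⟩ := (Submodule.mem_span_range_iff_exists_fun R).1 hxs
    exact ⟨_, fun i _ => shiftProj_mem 𝒜 1 (γ i) (j + a) (r i),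
      exists_sum_shiftPiece 𝒜 𝒜 one_pos (mul_mem_weighted 𝒜) hg
        (SetLike.mul_mem_graded hx hs) r hr⟩
  · intro x hx y hy hyx hys
    choose z hz using fun i => Ideal.mem_span_singleton'.1 (hys i trivial)
    refine (Submodule.mem_span_range_iff_exists_fun R).2 ⟨z, mul_right_cancel₀ hs0 ?_⟩
    rw [LinearMap.mulRight_apply] at hyx
    rw [← hyx]
    simp only [LinearMap.restrictScalars_apply, Fintype.linearCombination_apply, smul_eq_mul,
      Finset.sum_mul]
    exact Finset.sum_congr rfl fun i _ => by rw [← hz i]; ring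

theorem ringKrullDim_quotient_span_le [IsDomain R] {e : ℕ} (hdim : ringKrullDim R = (e + 2 : ℕ))
    {s : R} (hs0 : s ≠ 0) : ringKrullDim (R ⧸ Ideal.span {s}) ≤ (e + 1 : ℕ) := by
  have h := ringKrullDim_quotient_succ_le_of_nonZeroDivisor (mem_nonZeroDivisors_of_ne_zero hs0)
  rw [hdim] at h
  exact ENat.WithBot.add_le_add_one_right_iff.1 (by exact_mod_cast h)

theorem polyBound_relDim_span_singleton [IsDomain R] [IsNoetherianRing R]
    [∀ j, FiniteDimensional k (𝒜 j)] {e : ℕ} (hdim : ringKrullDim R = (e + 2 : ℕ))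
    {a : ℕ} {s : R} (hs : s ∈ 𝒜 a) (hs0 : s ≠ 0) :
    PolyBound (e + 1) (fun j => relDim (𝒜 j) ((Ideal.span {s}).restrictScalars k)) :=
  polyBound_relDim 𝒜 _ (Ideal.homogeneous_span 𝒜 _ (by rintro x rfl; exact ⟨a, hs⟩)) _
    (ringKrullDim_quotient_span_le hdim hs0)

theorem unifBound_relDim [IsNoetherianRing R] [∀ j, FiniteDimensional k (𝒜 j)] {e : ℕ}
    (hdim : ringKrullDim R = (e + 2 : ℕ)) (B : ℕ → Ideal R) : UnifBound (e + 1) (fun n j =>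
    (relDim (𝒜 j) ((B n).restrictScalars k) : ℝ)) := by
  have h : ringKrullDim (R ⧸ (⊥ : Ideal R)) ≤ (e + 2 : ℕ) := by
    rw [← hdim]
    exact ringKrullDim_quotient_le _
  refine (polyBound_relDim 𝒜 ⊥ (Ideal.IsHomogeneous.bot 𝒜) (e + 2) h).unifBound fun n j =>
    ⟨j, le_rfl, relDim_mono_right _ ?_⟩
  intro x _ hx
  have : x = 0 := by simpa using hx
  rw [this]
  exact zero_mem _

/-- Every member of the family `B` of ideals is generated by `μ` homogeneous elements. -/
def UnifGenerated (μ : ℕ) (B : ℕ → Ideal R) : Prop :=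
  ∀ n, ∃ (g : Fin μ → R) (γ : Fin μ → ℕ), (∀ i, g i ∈ 𝒜 (γ i)) ∧ B n = Ideal.span (Set.range g)

variable {𝒜} in
theorem UnifGenerated.isHomogeneous {μ : ℕ} {B : ℕ → Ideal R} (hB : UnifGenerated 𝒜 μ B) (n : ℕ) :
    (B n).IsHomogeneous 𝒜 := by
  obtain ⟨g, γ, hg, h⟩ := hB n
  rw [h]
  exact Ideal.homogeneous_span 𝒜 _ (by rintro x ⟨i, rfl⟩; exact ⟨_, hg i⟩)

variable [IsDomain R] [IsNoetherianRing R] [∀ j, FiniteDimensional k (𝒜 j)] {e : ℕ}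
  (hdim : ringKrullDim R = (e + 2 : ℕ)) {μ : ℕ} {B : ℕ → Ideal R} (hB : UnifGenerated 𝒜 μ B)

include hdim hB

theorem unifBound_relDim_degree_sub {a : ℕ} {s : R} (hs : s ∈ 𝒜 a) (hs0 : s ≠ 0) :
    UnifBound e (fun n j => (relDim (𝒜 (j + a)) ((B n).restrictScalars k) : ℝ) -
      relDim (𝒜 j) ((B n).restrictScalars k)) := by
  have hpb := polyBound_relDim_span_singleton 𝒜 hdim hs hs0
  choose g γ hg hgB using hB
  have h1 : UnifBound e (fun (_ : ℕ) j =>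
      (relDim (𝒜 j) ((Ideal.span {s}).restrictScalars k) : ℝ)) :=
    hpb.unifBound fun n j => ⟨j, le_rfl, le_rfl⟩
  have h2 : UnifBound e (fun n j => ∑ i, (relDim (shiftPiece 𝒜 1 (γ n i) j)
      ((Ideal.span {s}).restrictScalars k) : ℝ)) :=
    UnifBound.sum _ fun i _ => hpb.unifBound fun n j =>
      exists_relDim_shiftPiece_le 𝒜 one_pos _ _ _
  have h1' := h1.comp 1 a 0
  have h2' := h2.comp 1 a 0
  simp only [one_mul, add_zero] at h1' h2'
  refine UnifBound.of_le_between h1' h2' (fun n j => ?_) (fun n j => ?_)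
  · have hh := relDim_le_sup_span 𝒜 (UnifGenerated.isHomogeneous
      (fun n => ⟨g n, γ n, hg n, hgB n⟩) n) hs (J' := B n) (fun r hr => (B n).mul_mem_right _ hr)
      (j + a)
    rw [if_pos (by omega), Nat.add_sub_cancel] at hh
    have hh2 : relDim (𝒜 (j + a)) ((B n ⊔ Ideal.span {s}).restrictScalars k) ≤
        relDim (𝒜 (j + a)) ((Ideal.span {s}).restrictScalars k) :=
      relDim_mono_right _ fun x _ hx => Ideal.mem_sup_right hx
    exact_mod_cast hh.trans (by omega)
  · have hh := relDim_le_of_mul_injective 𝒜 (hg n) hs hs0 j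
    rw [← hgB n] at hh
    exact_mod_cast hh

variable {n₀ : ℕ} (hn₀dvd : ∀ m, 0 < m → 𝒜 m ≠ ⊥ → n₀ ∣ m)
  (hn₀gcd : ∀ c : ℕ, (∀ m, 0 < m → 𝒜 m ≠ ⊥ → c ∣ m) → c ∣ n₀)

include hn₀dvd hn₀gcd

omit hdim hB [IsNoetherianRing R] [∀ j, FiniteDimensional k (𝒜 j)] in
theorem exists_consecutive_degrees : ∃ t, 𝒜 (n₀ * t) ≠ ⊥ ∧ 𝒜 (n₀ * t + n₀) ≠ ⊥ := by
  have hmul : ∀ {a b}, 𝒜 a ≠ ⊥ → 𝒜 b ≠ ⊥ → 𝒜 (a + b) ≠ ⊥ := by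
    intro a b ha hb
    obtain ⟨x, hx, hx0⟩ := (Submodule.ne_bot_iff _).1 ha
    obtain ⟨y, hy, hy0⟩ := (Submodule.ne_bot_iff _).1 hb
    exact (Submodule.ne_bot_iff _).2 ⟨_, SetLike.mul_mem_graded hx hy, mul_ne_zero hx0 hy0⟩
  have h0 : 𝒜 0 ≠ ⊥ := (Submodule.ne_bot_iff _).2 ⟨1, SetLike.one_mem_graded 𝒜, one_ne_zero⟩
  let D : AddSubgroup ℤ :=
    { carrier := {z | ∃ a b, 𝒜 a ≠ ⊥ ∧ 𝒜 b ≠ ⊥ ∧ z = (a : ℤ) - b}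
      zero_mem' := ⟨0, 0, h0, h0, by simp⟩
      add_mem' := by
        rintro _ _ ⟨a, b, ha, hb, rfl⟩ ⟨a', b', ha', hb', rfl⟩
        exact ⟨a + a', b + b', hmul ha ha', hmul hb hb', by push_cast; ring⟩
      neg_mem' := by
        rintro _ ⟨a, b, ha, hb, rfl⟩
        exact ⟨b, a, hb, ha, by ring⟩ }
  obtain ⟨c, hc⟩ := Int.subgroup_cyclic D
  have hcn : c.natAbs ∣ n₀ := by
    refine hn₀gcd _ fun m _ hm => ?_
    have : (m : ℤ) ∈ D := ⟨m, 0, hm, h0, by simp⟩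
    rw [hc, AddSubgroup.mem_closure_singleton] at this
    obtain ⟨z, hz⟩ := this
    rw [← Int.natCast_dvd_natCast, Int.natAbs_dvd]
    exact ⟨z, by rw [← hz, smul_eq_mul, mul_comm]⟩
  have hn : (n₀ : ℤ) ∈ D := by
    rw [hc, AddSubgroup.mem_closure_singleton]
    rw [← Int.natCast_dvd_natCast, Int.natAbs_dvd] at hcn
    obtain ⟨z, hz⟩ := hcn
    exact ⟨z, by rw [hz, smul_eq_mul, mul_comm]⟩
  obtain ⟨a, b, ha, hb, hab⟩ := hn
  obtain ⟨t, rfl⟩ : n₀ ∣ b := by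
    rcases Nat.eq_zero_or_pos b with rfl | hpos
    · exact dvd_zero _
    · exact hn₀dvd b hpos hb
  have : a = n₀ * t + n₀ := by omega
  exact ⟨t, hb, this ▸ ha⟩

theorem unifBound_relDim_sub (c : ℕ) :
    UnifBound e (fun n j => (relDim (𝒜 (j + n₀ * c)) ((B n).restrictScalars k) : ℝ) -
      relDim (𝒜 j) ((B n).restrictScalars k)) := by
  obtain ⟨t, h1, h2⟩ := exists_consecutive_degrees 𝒜 hn₀dvd hn₀gcd
  obtain ⟨x, hx, hx0⟩ := (Submodule.ne_bot_iff _).1 h1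
  obtain ⟨y, hy, hy0⟩ := (Submodule.ne_bot_iff _).1 h2
  have hx' := (unifBound_relDim_degree_sub 𝒜 hdim hB hx hx0).comp 1 n₀ 0
  have hy' := unifBound_relDim_degree_sub 𝒜 hdim hB hy hy0
  have hstep : UnifBound e (fun n j => (relDim (𝒜 (j + n₀)) ((B n).restrictScalars k) : ℝ) -
      relDim (𝒜 j) ((B n).restrictScalars k)) := by
    convert hy'.sub hx' using 3 with n j
    rw [one_mul, add_zero, show j + n₀ + n₀ * t = j + (n₀ * t + n₀) by ring]
    ring
  induction c with
  | zero => simpa using UnifBound.zero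
  | succ c ih =>
    convert ih.add (hstep.comp 1 (n₀ * c) 0) using 3 with n j
    rw [one_mul, add_zero, show j + n₀ * (c + 1) = j + n₀ * c + n₀ by ring]
    ring

end Estimates

section Comparison

variable {k : Type*} [Field k] {R : Type*} [CommRing R] [Algebra k R]
  (𝒜 : ℕ → Submodule k R) [GradedAlgebra 𝒜]
  {M : Type*} [AddCommGroup M] [Module R M] [Module k M] [IsScalarTower k R M]
  (ℳ : ℕ → Submodule k M) [DirectSum.Decomposition ℳ]

theorem shiftProj_mul_of_mem {w : ℕ} (hw : 0 < w) {a b j : ℕ} {s y z : R} (hs : s ∈ 𝒜 a)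
    (hy : y ∈ shiftPiece 𝒜 w b (j + w * a)) (hz : z * s = y) : shiftProj 𝒜 w b j z * s = y := by
  by_cases h : ∃ c, j = w * c + b
  · obtain ⟨c, rfl⟩ := h
    rw [show w * c + b + w * a = w * (c + a) + b by ring, shiftPiece_add 𝒜 hw] at hy
    rw [shiftProj_add_degree 𝒜 hw, ← DirectSum.decompose_of_mem_same 𝒜 hy, ← hz,
      DirectSum.coe_decompose_mul_add_of_right_mem 𝒜 hs]
  · push Not at h
    rw [shiftProj_eq_zero 𝒜 h, zero_mul]
    obtain ⟨c, hc, hp⟩ | ⟨-, hp⟩ := shiftPiece_cases 𝒜 hw b (j + w * a)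
    · rw [hp] at hy
      have hca : ¬ a ≤ c := by
        intro hac
        obtain ⟨t, rfl⟩ := Nat.exists_eq_add_of_le hac
        exact h t (by rw [mul_add] at hc; omega)
      rw [← DirectSum.decompose_of_mem_same 𝒜 hy, ← hz,
        DirectSum.coe_decompose_mul_of_right_mem_of_not_le 𝒜 hs hca]
    · rw [hp, Submodule.mem_bot] at hy
      exact hy.symm

variable [∀ j, FiniteDimensional k (𝒜 j)] {w : ℕ} (hw : 0 < w)
  (hsm : ∀ a j, ∀ r ∈ 𝒜 a, ∀ m ∈ ℳ j, r • m ∈ ℳ (w * a + j))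

include hw hsm

theorem relDim_le_add_sum_shiftPiece (j : ℕ) [FiniteDimensional k (ℳ j)] {ι : Type*} [Fintype ι]
    {b : ι → ℕ} {v : ι → M} (hv : ∀ i, v i ∈ ℳ (b i)) (W : Submodule R M) (J : Ideal R)
    (hJ : ∀ i, ∀ r ∈ J, r • v i ∈ W) :
    relDim (ℳ j) (W.restrictScalars k) ≤
      relDim (ℳ j) ((Submodule.span R (Set.range v)).restrictScalars k) +
        ∑ i, relDim (shiftPiece 𝒜 w (b i) j) (J.restrictScalars k) := by
  have := fun i => finiteDimensional_shiftPiece 𝒜 w (b i) j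
  have := finiteDimensional_pi fun i => shiftPiece 𝒜 w (b i) j
  rw [← relDim_pi]
  refine relDim_le_add _ _ _ _ _ ((Fintype.linearCombination R v).restrictScalars k) ?_ ?_ ?_
  · intro z hz
    exact sum_mem fun i _ => shiftPiece_smul_mem 𝒜 ℳ hw hsm (hv i) (hz i trivial)
  · intro z _ hz
    exact W.sum_mem fun i _ => hJ i _ (hz i trivial)
  · intro y hy hyv
    obtain ⟨r, hr⟩ := (Submodule.mem_span_range_iff_exists_fun R).1 hyv
    refine ⟨_, fun i _ => shiftProj_mem 𝒜 w (b i) j (r i), ?_⟩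
    have h : ∑ i, shiftProj 𝒜 w (b i) j (r i) • v i = y :=
      exists_sum_shiftPiece 𝒜 ℳ hw hsm hv hy r hr
    rw [LinearMap.restrictScalars_apply, Fintype.linearCombination_apply, h, sub_self]
    exact zero_mem _

theorem relDim_smul_top_le (j : ℕ) [FiniteDimensional k (ℳ j)] {ι κ : Type*} [Fintype ι] [Fintype κ]
    {b : ι → ℕ} {v : ι → M} (hv : ∀ i, v i ∈ ℳ (b i)) (hspan : Submodule.span R (Set.range v) = ⊤)
    {b' : κ → ℕ} {u : κ → M} (hu : ∀ i, u i ∈ ℳ (b' i)) {s : R}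
    (hsv : ∀ x : M, s • x ∈ Submodule.span R (Set.range u)) (J : Ideal R) :
    relDim (ℳ j) ((J • (⊤ : Submodule R M)).restrictScalars k) ≤
      ∑ i, relDim (shiftPiece 𝒜 w (b i) j) ((Ideal.span {s}).restrictScalars k) +
        ∑ i, relDim (shiftPiece 𝒜 w (b' i) j) (J.restrictScalars k) := by
  refine (relDim_le_add_sum_shiftPiece 𝒜 ℳ hw hsm j hu _ J
    fun i r hr => Submodule.smul_mem_smul hr Submodule.mem_top).trans (Nat.add_le_add_right ?_ _)
  refine (relDim_le_add_sum_shiftPiece 𝒜 ℳ hw hsm j hv _ (Ideal.span {s}) ?_).trans ?_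
  · intro i r hr
    obtain ⟨c, rfl⟩ := Ideal.mem_span_singleton'.1 hr
    rw [mul_smul]
    exact Submodule.smul_mem _ _ (hsv _)
  · rw [hspan, Submodule.restrictScalars_top, relDim_eq_zero le_top, zero_add]

theorem sum_relDim_shiftPiece_le (j : ℕ) [FiniteDimensional k (ℳ j)] {κ : Type*} [Fintype κ]
    {b' : κ → ℕ} {u : κ → M} (hu : ∀ i, u i ∈ ℳ (b' i)) (hli : LinearIndependent R u)
    {a : ℕ} {s : R} (hs : s ∈ 𝒜 a)
    (hsv : ∀ x : M, s • x ∈ Submodule.span R (Set.range u)) (J : Ideal R) :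
    ∑ i, relDim (shiftPiece 𝒜 w (b' i) (j + w * a)) (J.restrictScalars k) ≤
      ∑ i, relDim (shiftPiece 𝒜 w (b' i) (j + w * a)) ((Ideal.span {s}).restrictScalars k) +
      relDim (ℳ j) ((J • (⊤ : Submodule R M)).restrictScalars k) := by
  have := fun i => finiteDimensional_shiftPiece 𝒜 w (b' i) (j + w * a)
  have := finiteDimensional_pi fun i => shiftPiece 𝒜 w (b' i) (j + w * a)
  let ψ : M →ₗ[R] κ → R := Finsupp.lcoeFun ∘ₗ hli.repr ∘ₗ
    (LinearMap.lsmul R M s).codRestrict _ hsv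
  have hψ : ∀ x, ∑ i, ψ x i • u i = s • x := by
    intro x
    have := hli.linearCombination_repr ⟨s • x, hsv x⟩
    rwa [Finsupp.linearCombination_apply,
      Finsupp.sum_fintype _ _ fun i => zero_smul R (u i)] at this
  have hinj : ∀ y z : κ → R, ∑ i, y i • u i = ∑ i, z i • u i → y = z := fun y z h =>
    hli.fintypeLinearCombination_injective h
  rw [← relDim_pi, ← relDim_pi]
  refine relDim_le_add _ _ _ _ _ (ψ.restrictScalars k) ?_ ?_ ?_
  · intro x hx
    have h1 : s • x ∈ ℳ (j + w * a) := by
      rw [add_comm]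
      exact hsm a j s hs x hx
    have h2 := exists_sum_shiftPiece 𝒜 ℳ hw hsm hu h1 _ (hψ x)
    rw [← hψ x] at h2
    rw [LinearMap.restrictScalars_apply, ← hinj _ _ h2]
    exact fun i _ => shiftProj_mem 𝒜 w (b' i) _ _
  · intro x _ hx i _
    have : J • (⊤ : Submodule R M) ≤ Submodule.comap (LinearMap.proj i ∘ₗ ψ) J := by
      refine Submodule.smul_le.2 fun r hr m _ => ?_
      rw [Submodule.mem_comap, map_smul, smul_eq_mul]
      exact J.mul_mem_right _ hr
    exact this hx
  · intro y hy hys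
    choose z hz using fun i => Ideal.mem_span_singleton'.1 (hys i trivial)
    have hz' := fun i => shiftProj_mul_of_mem 𝒜 hw hs (hy i trivial) (hz i)
    refine ⟨∑ i, shiftProj 𝒜 w (b' i) j (z i) • u i, sum_mem fun i _ =>
      shiftPiece_smul_mem 𝒜 ℳ hw hsm (hu i) (shiftProj_mem 𝒜 w (b' i) j _), ?_⟩
    have : ψ (∑ i, shiftProj 𝒜 w (b' i) j (z i) • u i) = y := by
      refine hinj _ _ ((hψ _).trans ?_)
      rw [Finset.smul_sum]
      exact Finset.sum_congr rfl fun i _ => by rw [← hz' i, smul_smul, mul_comm]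
    rw [LinearMap.restrictScalars_apply, this, sub_self]
    exact zero_mem _

end Comparison

section BlockSum

variable {k : Type*} [Field k] {R : Type*} [CommRing R] [Algebra k R]
  (𝒜 : ℕ → Submodule k R)

theorem sum_relDim_shiftPiece_add {n₀ : ℕ} (hn₀ : 0 < n₀)
    (hn₀dvd : ∀ m, 0 < m → 𝒜 m ≠ ⊥ → n₀ ∣ m) {w : ℕ} (hw : 0 < w) (J : Submodule k R) (b m : ℕ) :
    ∑ i ∈ Finset.range (w * n₀),
        relDim (shiftPiece 𝒜 w b (w * n₀ * (m + b / (w * n₀)) + i)) J =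
      relDim (𝒜 (n₀ * m)) J := by
  have hb := Nat.div_add_mod b (w * n₀)
  have hlt := Nat.mod_lt b (Nat.mul_pos hw hn₀)
  rw [Finset.sum_eq_single (b % (w * n₀))]
  · rw [show w * n₀ * (m + b / (w * n₀)) + b % (w * n₀) = w * (n₀ * m) + b by
      rw [mul_add, add_assoc, hb]; ring, shiftPiece_add 𝒜 hw]
  · intro i hi hne
    obtain ⟨a, ha, h⟩ | ⟨-, h⟩ := shiftPiece_cases 𝒜 hw b (w * n₀ * (m + b / (w * n₀)) + i)
    · rw [h]
      by_cases h0 : 𝒜 a = ⊥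
      · rw [h0]
        exact relDim_eq_zero bot_le
      · obtain ⟨c, rfl⟩ : n₀ ∣ a := by
          rcases Nat.eq_zero_or_pos a with rfl | hpos
          · exact dvd_zero _
          · exact hn₀dvd a hpos h0
        have h1 : (w * n₀ * (m + b / (w * n₀)) + i) % (w * n₀) = i := by
          rw [Nat.mul_add_mod, Nat.mod_eq_of_lt (Finset.mem_range.1 hi)]
        have h2 : (w * (n₀ * c) + b) % (w * n₀) = b % (w * n₀) := by
          rw [← mul_assoc, Nat.mul_add_mod]
        rw [ha, h2] at h1
        exact absurd h1.symm hne
    · rw [h]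
      exact relDim_eq_zero bot_le
  · intro h
    exact absurd (Finset.mem_range.2 hlt) h

theorem sum_relDim_shiftPiece_eq_zero {n₀ w : ℕ} (J : Submodule k R)
    {b m : ℕ} (hm : m < b / (w * n₀)) :
    ∑ i ∈ Finset.range (w * n₀), relDim (shiftPiece 𝒜 w b (w * n₀ * m + i)) J = 0 := by
  refine Finset.sum_eq_zero fun i hi => ?_
  rw [shiftPiece_eq_bot, relDim_eq_zero bot_le]
  intro a ha
  have h1 := Nat.div_mul_le_self b (w * n₀)
  have h2 : w * n₀ * (m + 1) ≤ w * n₀ * (b / (w * n₀)) := Nat.mul_le_mul_left _ hm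
  have h3 := Finset.mem_range.1 hi
  rw [mul_comm] at h1
  rw [mul_add] at h2
  omega

variable [GradedAlgebra 𝒜] [IsDomain R] [IsNoetherianRing R] [∀ j, FiniteDimensional k (𝒜 j)]
  {e : ℕ} (hdim : ringKrullDim R = (e + 2 : ℕ)) {μ : ℕ} {B : ℕ → Ideal R}
  (hB : UnifGenerated 𝒜 μ B) {n₀ : ℕ} (hn₀ : 0 < n₀)
  (hn₀dvd : ∀ m, 0 < m → 𝒜 m ≠ ⊥ → n₀ ∣ m)
  (hn₀gcd : ∀ c : ℕ, (∀ m, 0 < m → 𝒜 m ≠ ⊥ → c ∣ m) → c ∣ n₀)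

include hdim hB hn₀ hn₀dvd hn₀gcd

theorem unifBound_sum_relDim_shiftPiece_sub {w : ℕ} (hw : 0 < w) (b : ℕ) :
    UnifBound e (fun n m => (∑ i ∈ Finset.range (w * n₀),
        (relDim (shiftPiece 𝒜 w b (w * n₀ * m + i)) ((B n).restrictScalars k) : ℝ)) -
      relDim (𝒜 (n₀ * m)) ((B n).restrictScalars k)) := by
  obtain ⟨C, hC, hbd⟩ := (unifBound_relDim_sub 𝒜 hdim hB hn₀dvd hn₀gcd (b / (w * n₀))).comp n₀ 0 0
  obtain ⟨D, hD, hbd'⟩ := (unifBound_relDim 𝒜 hdim B).comp n₀ 0 0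
  simp only [add_zero] at hbd hbd'
  refine ⟨C + D * (b / (w * n₀) : ℕ), by positivity, fun n m => ?_⟩
  rcases lt_or_ge m (b / (w * n₀)) with hm | hm
  · have h := sum_relDim_shiftPiece_eq_zero 𝒜 ((B n).restrictScalars k) hm
    have h' : (∑ i ∈ Finset.range (w * n₀),
        (relDim (shiftPiece 𝒜 w b (w * n₀ * m + i)) ((B n).restrictScalars k) : ℝ)) = 0 := by
      exact_mod_cast h
    beta_reduce
    rw [h', zero_sub, abs_neg]
    refine (hbd' n m).trans ?_
    rw [pow_succ', ← mul_assoc]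
    have : ((m : ℝ) + 1) ≤ (b / (w * n₀) : ℕ) := by exact_mod_cast hm
    gcongr
    nlinarith
  · obtain ⟨t, rfl⟩ := Nat.exists_eq_add_of_le' hm
    have h := sum_relDim_shiftPiece_add 𝒜 hn₀ hn₀dvd hw ((B n).restrictScalars k) b t
    have h' : (∑ i ∈ Finset.range (w * n₀), (relDim (shiftPiece 𝒜 w b
        (w * n₀ * (t + b / (w * n₀)) + i)) ((B n).restrictScalars k) : ℝ)) =
          relDim (𝒜 (n₀ * t)) ((B n).restrictScalars k) := by
      exact_mod_cast h
    beta_reduce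
    rw [h', abs_sub_comm, mul_add]
    refine (hbd n t).trans ?_
    gcongr
    · exact le_add_of_nonneg_right (by positivity)
    · exact Nat.le_add_right _ _

variable {M : Type*} [AddCommGroup M] [Module R M] [Module k M] [IsScalarTower k R M]
  (ℳ : ℕ → Submodule k M) [DirectSum.Decomposition ℳ]

theorem unifBound_sum_relDim_smul_top_sub {w : ℕ} (hw : 0 < w)
    (hsm : ∀ a j, ∀ r ∈ 𝒜 a, ∀ m ∈ ℳ j, r • m ∈ ℳ (w * a + j))
    {ι κ : Type*} [Fintype ι] [Fintype κ]
    {b : ι → ℕ} {v : ι → M} (hv : ∀ i, v i ∈ ℳ (b i)) (hspan : Submodule.span R (Set.range v) = ⊤)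
    {b' : κ → ℕ} {u : κ → M} (hu : ∀ i, u i ∈ ℳ (b' i)) (hli : LinearIndependent R u)
    {a : ℕ} {s : R} (hs : s ∈ 𝒜 a) (hs0 : s ≠ 0)
    (hsv : ∀ x : M, s • x ∈ Submodule.span R (Set.range u)) :
    UnifBound e (fun n m => (∑ i ∈ Finset.range (w * n₀),
        (relDim (ℳ (w * n₀ * m + i)) ((B n • (⊤ : Submodule R M)).restrictScalars k) : ℝ)) -
      Fintype.card κ * relDim (𝒜 (n₀ * m)) ((B n).restrictScalars k)) := by
  have hfin := finiteDimensional_modulePiece 𝒜 ℳ hw hsm hv hspan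
  obtain ⟨c, rfl⟩ : n₀ ∣ a := by
    rcases Nat.eq_zero_or_pos a with rfl | hpos
    · exact dvd_zero _
    · exact hn₀dvd a hpos ((Submodule.ne_bot_iff _).2 ⟨s, hs, hs0⟩)
  have hpb := polyBound_relDim_span_singleton 𝒜 hdim hs hs0
  have htors : ∀ β t : ℕ, UnifBound e (fun _ m => (∑ i ∈ Finset.range (w * n₀),
      (relDim (shiftPiece 𝒜 w β (w * n₀ * m + i + t))
        ((Ideal.span {s}).restrictScalars k) : ℝ))) := by
    intro β t
    refine UnifBound.sum _ fun i _ => ?_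
    have := (hpb.unifBound (f := fun (_ : ℕ) j =>
      relDim (shiftPiece 𝒜 w β j) ((Ideal.span {s}).restrictScalars k)) fun n j =>
      exists_relDim_shiftPiece_le 𝒜 hw _ _ _).comp (w * n₀) (i + t) 0
    simpa only [add_assoc] using this
  have hG := fun i => unifBound_sum_relDim_shiftPiece_sub 𝒜 hdim hB hn₀ hn₀dvd hn₀gcd hw (b' i)
  have hG1 := UnifBound.sum Finset.univ fun i (_ : i ∈ Finset.univ) => hG i
  have hG2 := UnifBound.sum Finset.univ fun i (_ : i ∈ Finset.univ) => (hG i).comp 1 c 0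
  have hL := UnifBound.sum (Finset.univ : Finset κ) fun _ _ =>
    (unifBound_relDim_sub 𝒜 hdim hB hn₀dvd hn₀gcd c).comp n₀ 0 0
  have hA := UnifBound.sum Finset.univ fun i (_ : i ∈ Finset.univ) => htors (b i) 0
  have hA' := UnifBound.sum Finset.univ fun i (_ : i ∈ Finset.univ) =>
    htors (b' i) (w * (n₀ * c))
  simp only [add_zero, one_mul] at hG1 hG2 hL hA
  refine UnifBound.of_le_between (hA.add hG1) ((hA'.sub hG2).sub hL) (fun n m => ?_) (fun n m => ?_)
  · have h := Finset.sum_le_sum fun i (_ : i ∈ Finset.range (w * n₀)) =>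
      relDim_smul_top_le 𝒜 ℳ hw hsm (w * n₀ * m + i) hv hspan hu hsv (B n)
    rw [Finset.sum_add_distrib, Finset.sum_comm,
      Finset.sum_comm (t := (Finset.univ : Finset κ))] at h
    have h' : ((_ : ℕ) : ℝ) ≤ ((_ : ℕ) : ℝ) := Nat.cast_le.2 h
    push_cast at h'
    rw [Finset.sum_sub_distrib, Finset.sum_const, Finset.card_univ, nsmul_eq_mul]
    linarith
  · have h := Finset.sum_le_sum fun i (_ : i ∈ Finset.range (w * n₀)) =>
      sum_relDim_shiftPiece_le 𝒜 ℳ hw hsm (w * n₀ * m + i) hu hli hs hsv (B n)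
    rw [Finset.sum_add_distrib, Finset.sum_comm,
      Finset.sum_comm (t := (Finset.univ : Finset κ))] at h
    have h' : ((_ : ℕ) : ℝ) ≤ ((_ : ℕ) : ℝ) := Nat.cast_le.2 h
    push_cast at h'
    simp only [Finset.sum_sub_distrib, Finset.sum_const, Finset.card_univ, nsmul_eq_mul, mul_add,
      ← mul_assoc] at h' ⊢
    simp only [add_right_comm (w * n₀ * m) _ (w * n₀ * c)] at h' ⊢
    linarith

end BlockSum

section Generators

variable {k : Type*} [Field k] {R : Type*} [CommRing R] [Algebra k R]
  (𝒜 : ℕ → Submodule k R) [GradedAlgebra 𝒜]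
  {M : Type*} [AddCommGroup M] [Module R M] [Module k M]
  (ℳ : ℕ → Submodule k M) [DirectSum.Decomposition ℳ]

omit [Algebra k R] in
theorem exists_homogeneous_generators {P : Submodule R M} (hP : P.FG)
    (hhom : ∀ x ∈ P, ∀ j, (DirectSum.decompose ℳ x j : M) ∈ P) :
    ∃ (N : ℕ) (v : Fin N → M) (b : Fin N → ℕ), (∀ i, v i ∈ ℳ (b i)) ∧
      Submodule.span R (Set.range v) = P := by
  classical
  have hspan : Submodule.span R {x | x ∈ P ∧ ∃ j, x ∈ ℳ j} = P := by
    refine le_antisymm (Submodule.span_le.2 fun x hx => hx.1) fun x hx => ?_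
    rw [← DirectSum.sum_support_decompose ℳ x]
    exact sum_mem fun j _ => Submodule.subset_span ⟨hhom x hx j, j, SetLike.coe_mem _⟩
  obtain ⟨S, hS, hSP⟩ := (Submodule.fg_span_iff_fg_span_finset_subset _).1 (hspan ▸ hP)
  rw [hspan] at hSP
  choose b hb using fun i => (hS (S.equivFin.symm i).2).2
  refine ⟨S.card, fun i => S.equivFin.symm i, b, hb, ?_⟩
  rw [hSP]
  congr 1
  ext x
  constructor
  · rintro ⟨i, rfl⟩
    exact (S.equivFin.symm i).2
  · intro hx
    exact ⟨S.equivFin ⟨x, hx⟩, by simp⟩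

theorem exists_homogeneous_basis [IsDomain R] [Module.Finite R M] {w : ℕ} (hw : 0 < w)
    (hsm : ∀ a j, ∀ r ∈ 𝒜 a, ∀ m ∈ ℳ j, r • m ∈ ℳ (w * a + j)) {ι : Type*} [Finite ι]
    {b : ι → ℕ} {v : ι → M} (hv : ∀ i, v i ∈ ℳ (b i))
    (hspan : Submodule.span R (Set.range v) = ⊤) :
    ∃ σ : Set ι, LinearIndependent R (fun i : σ => v i) ∧ Nat.card σ = Module.finrank R M ∧
      ∃ (a : ℕ) (s : R), s ∈ 𝒜 a ∧ s ≠ 0 ∧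
        ∀ x : M, s • x ∈ Submodule.span R (Set.range fun i : σ => v i) := by
  classical
  have := Fintype.ofFinite ι
  obtain ⟨σ, hσ, hmax⟩ := exists_maximal_linearIndepOn R v
  set U := Submodule.span R (Set.range fun i : σ => v i) with hU
  have hUim : Submodule.span R (v '' σ) = U := by rw [hU, Set.image_eq_range]
  have h1 : ∀ i, ∃ a : R, a ≠ 0 ∧ a • v i ∈ U := by
    intro i
    by_cases hi : i ∈ σ
    · exact ⟨1, one_ne_zero, by rw [one_smul]; exact Submodule.subset_span ⟨⟨i, hi⟩, rfl⟩⟩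
    · rw [← hUim]
      exact hmax i hi
  choose a ha0 ha using h1
  have hS0 : ∏ i, a i ≠ 0 := Finset.prod_ne_zero_iff.2 fun i _ => ha0 i
  have hS : ∀ i, (∏ i, a i) • v i ∈ U := by
    intro i
    rw [← Finset.prod_erase_mul _ _ (Finset.mem_univ i), mul_smul]
    exact U.smul_mem _ (ha i)
  have hext : ∀ s : R, (∀ i, s • v i ∈ U) → ∀ x : M, s • x ∈ U := by
    intro s hs x
    have hx : x ∈ Submodule.span R (Set.range v) := hspan ▸ Submodule.mem_top
    have : Submodule.span R (Set.range v) ≤ U.comap (LinearMap.lsmul R M s) :=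
      Submodule.span_le.2 (by rintro _ ⟨i, rfl⟩; exact hs i)
    exact this hx
  refine ⟨σ, hσ, ?_, ?_⟩
  · have hq : Module.rank R (M ⧸ U) = 0 := by
      rw [rank_eq_zero_iff]
      intro x
      obtain ⟨y, rfl⟩ := U.mkQ_surjective x
      refine ⟨_, hS0, ?_⟩
      rw [← map_smul, Submodule.mkQ_apply, Submodule.Quotient.mk_eq_zero]
      exact hext _ hS y
    have hrn : Module.rank R (M ⧸ U) + Module.rank R U = Module.rank R M :=
      rank_quotient_add_rank_of_isDomain U
    have hUr : Module.finrank R U = Nat.card σ := by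
      rw [Nat.card_eq_fintype_card]
      exact finrank_span_eq_card hσ
    rw [hq, zero_add] at hrn
    rw [← hUr, Module.finrank, Module.finrank, hrn]
  · have hne : ∃ c, (DirectSum.decompose 𝒜 (∏ i, a i) c : R) ≠ 0 := by
      by_contra! h
      refine hS0 ?_
      rw [← DirectSum.sum_support_decompose 𝒜 (∏ i, a i)]
      exact Finset.sum_eq_zero fun c _ => h c
    obtain ⟨c, hc⟩ := hne
    refine ⟨c, _, SetLike.coe_mem _, hc, hext _ fun i => ?_⟩
    rw [← shiftProj_add_degree 𝒜 hw (b i), ← decompose_smul_eq_shiftProj 𝒜 ℳ hw hsm (hv i)]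
    obtain ⟨r, hr⟩ := (Submodule.mem_span_range_iff_exists_fun R).1 (hS i)
    rw [← hr, DirectSum.decompose_sum, DFinsupp.finsetSum_apply, AddSubmonoidClass.coe_finsetSum]
    refine sum_mem fun t _ => ?_
    rw [decompose_smul_eq_shiftProj 𝒜 ℳ hw hsm (hv t)]
    exact U.smul_mem _ (Submodule.subset_span ⟨t, rfl⟩)

end Generators

section FrobeniusPow

variable {k : Type*} [Field k] {R : Type*} [CommRing R] [Algebra k R]
  (𝒜 : ℕ → Submodule k R) [GradedAlgebra 𝒜] (p : ℕ) [Fact p.Prime] [CharP R p]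

theorem frobeniusPow_eq_map (I : Ideal R) (n : ℕ) :
    I.frobeniusPow (p ^ n) = I.map (iterateFrobenius R p n) := rfl

theorem frobeniusPow_span_range {ι : Type*} (f : ι → R) (n : ℕ) :
    (Ideal.span (Set.range f)).frobeniusPow (p ^ n) =
      Ideal.span (Set.range fun i => f i ^ p ^ n) := by
  rw [frobeniusPow_eq_map, Ideal.map_span, ← Set.range_comp]
  rfl

theorem frobeniusPow_succ (I : Ideal R) (n : ℕ) :
    I.frobeniusPow (p ^ (n + 1)) = (I.frobeniusPow (p ^ n)).map (frobenius R p) := by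
  rw [frobeniusPow_eq_map, frobeniusPow_eq_map, Ideal.map_map]
  congr 1
  ext x
  simp [iterateFrobenius_def, frobenius_def, pow_succ, pow_mul]

theorem unifGenerated_frobeniusPow {μ : ℕ} {f : Fin μ → R} {δ : Fin μ → ℕ}
    (hf : ∀ i, f i ∈ 𝒜 (δ i)) :
    UnifGenerated 𝒜 μ fun n => (Ideal.span (Set.range f)).frobeniusPow (p ^ n) := fun n =>
  ⟨fun i => f i ^ p ^ n, fun i => p ^ n * δ i, fun i => by
    simpa using SetLike.pow_mem_graded (p ^ n) (hf i), frobeniusPow_span_range p f n⟩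

end FrobeniusPow

section Vanishing

theorem Ideal.span_image_pow_le {R ι : Type*} [CommRing R] (f : ι → R) (q : ℕ) (S : Finset ι) :
    Ideal.span (f '' S) ^ (S.card * q + 1) ≤ Ideal.span ((fun i => f i ^ q) '' S) := by
  classical
  induction S using Finset.induction_on with
  | empty => simp
  | insert a S ha ih =>
    rw [Finset.card_insert_of_notMem ha, show (S.card + 1) * q + 1 = q + (S.card * q + 1) by ring,
      Finset.coe_insert, Set.image_insert_eq, Set.image_insert_eq, Ideal.span_insert,
      Ideal.span_insert]
    refine Ideal.sup_pow_add_le_pow_sup_pow.trans (sup_le_sup ?_ ih)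
    rw [Ideal.span_singleton_pow]

variable {k : Type*} [Field k] {R : Type*} [CommRing R] [Algebra k R]
  (𝒜 : ℕ → Submodule k R) [GradedAlgebra 𝒜]

theorem exists_piece_le_of_finite_colength {I : Ideal R} (hI : I.IsHomogeneous 𝒜)
    [FiniteDimensional k (R ⧸ I)] : ∃ N, ∀ j, N ≤ j → ∀ x ∈ 𝒜 j, x ∈ I := by
  classical
  obtain ⟨t, y, hy⟩ := Module.Finite.exists_fin (R := k) (M := R ⧸ I)
  choose z hz using fun i => Ideal.Quotient.mk_surjective (y i)
  refine ⟨∑ i, ∑ j ∈ (DirectSum.decompose 𝒜 (z i)).support, (j + 1), fun j hj x hx => ?_⟩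
  have hzero : ∀ i, (DirectSum.decompose 𝒜 (z i) j : R) = 0 := by
    intro i
    by_contra hne
    have hmem : j ∈ (DirectSum.decompose 𝒜 (z i)).support := by
      rw [DFinsupp.mem_support_iff]
      exact fun h => hne (by rw [h]; rfl)
    have h1 := Finset.single_le_sum (f := fun j => j + 1) (fun _ _ => Nat.zero_le _) hmem
    have h2 := Finset.single_le_sum
      (f := fun i => ∑ j ∈ (DirectSum.decompose 𝒜 (z i)).support, (j + 1))
      (fun _ _ => Nat.zero_le _) (Finset.mem_univ i)
    simp only at h1 h2
    omega
  have hxm : Ideal.Quotient.mk I x ∈ Submodule.span k (Set.range y) := hy ▸ Submodule.mem_top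
  obtain ⟨c, hc⟩ := (Submodule.mem_span_range_iff_exists_fun k).1 hxm
  have hmem : x - ∑ i, c i • z i ∈ I := by
    rw [← Ideal.Quotient.eq, ← hc]
    have : ∀ r, Ideal.Quotient.mk I r = Ideal.Quotient.mkₐ k I r := fun _ => rfl
    rw [this, map_sum]
    refine Finset.sum_congr rfl fun i _ => ?_
    rw [map_smul, ← this, hz]
  have h := hI j hmem
  have hs : (DirectSum.decompose 𝒜 (∑ i, c i • z i) j : R) = 0 := by
    rw [DirectSum.decompose_sum, DFinsupp.finsetSum_apply, AddSubmonoidClass.coe_finsetSum]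
    refine Finset.sum_eq_zero fun i _ => ?_
    rw [DirectSum.decompose_smul, DirectSum.smul_apply, Submodule.coe_smul, hzero, smul_zero]
  rwa [DirectSum.decompose_sub, DirectSum.sub_apply, Submodule.coe_sub, hs, sub_zero,
    DirectSum.decompose_of_mem_same 𝒜 hx] at h

theorem piece_le_pow {μ : ℕ} {f : Fin μ → R} {δ : Fin μ → ℕ} (hf : ∀ i, f i ∈ 𝒜 (δ i)) {N Δ : ℕ}
    (hδ : ∀ i, δ i ≤ Δ) (hN : ∀ j, N ≤ j → ∀ x ∈ 𝒜 j, x ∈ Ideal.span (Set.range f)) (t : ℕ) :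
    ∀ j, N + t * Δ ≤ j → ∀ x ∈ 𝒜 j, x ∈ Ideal.span (Set.range f) ^ t := by
  induction t with
  | zero => simp
  | succ t ih =>
    intro j hj x hx
    rw [add_mul, one_mul] at hj
    obtain ⟨r, hr⟩ := (Submodule.mem_span_range_iff_exists_fun R).1 (hN j (by omega) x hx)
    rw [← exists_sum_shiftPiece 𝒜 𝒜 one_pos (mul_mem_weighted 𝒜) hf hx r hr, pow_succ]
    refine sum_mem fun i _ => Ideal.mul_mem_mul (ih (j - δ i) ?_ _ ?_) (Ideal.subset_span ⟨i, rfl⟩)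
    · have := hδ i
      omega
    · have h := shiftProj_mem 𝒜 1 (δ i) j (r i)
      have hj' : j = 1 * (j - δ i) + δ i := by
        have := hδ i
        omega
      rw [hj', shiftPiece_add 𝒜 one_pos] at h
      rw [hj']
      simpa using h

theorem exists_piece_le_frobeniusPow (p : ℕ) [Fact p.Prime] [CharP R p] {μ : ℕ} {f : Fin μ → R}
    {δ : Fin μ → ℕ} (hf : ∀ i, f i ∈ 𝒜 (δ i))
    [FiniteDimensional k (R ⧸ Ideal.span (Set.range f))] :
    ∃ C, ∀ n j, C * p ^ n ≤ j → 𝒜 j ≤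
      ((Ideal.span (Set.range f)).frobeniusPow (p ^ n)).restrictScalars k := by
  obtain ⟨N, hN⟩ := exists_piece_le_of_finite_colength 𝒜 (I := Ideal.span (Set.range f))
    (Ideal.homogeneous_span 𝒜 _ (by rintro x ⟨i, rfl⟩; exact ⟨_, hf i⟩))
  refine ⟨N + (μ + 1) * ∑ i, δ i, fun n j hj x hx => ?_⟩
  have hq : 1 ≤ p ^ n := Nat.one_le_pow _ _ (Fact.out : p.Prime).pos
  set Δ := ∑ i, δ i with hΔ
  have hjle : N + (μ * p ^ n + 1) * Δ ≤ j := by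
    refine le_trans ?_ hj
    nlinarith [Nat.mul_le_mul_left Δ hq, Nat.mul_le_mul_left N hq]
  have h := piece_le_pow 𝒜 hf (fun i => Finset.single_le_sum (fun _ _ => Nat.zero_le _)
    (Finset.mem_univ i)) hN (μ * p ^ n + 1) j hjle x hx
  have h2 := Ideal.span_image_pow_le f (p ^ n) Finset.univ
  simp only [Finset.card_univ, Fintype.card_fin, Finset.coe_univ, Set.image_univ] at h2
  rw [frobeniusPow_span_range]
  exact h2 h

end Vanishing

section FrobMod

/-- The ring `R` as a module over itself through the Frobenius map. -/
def FrobMod (_p : ℕ) (R : Type*) : Type _ := R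

variable {k : Type*} [Field k] {R : Type*} [CommRing R] [Algebra k R] (p : ℕ) [Fact p.Prime]
  [CharP R p] [CharP k p]

instance : AddCommGroup (FrobMod p R) := inferInstanceAs (AddCommGroup R)

instance : Module R (FrobMod p R) := Module.compHom R (frobenius R p)

instance : Module k (FrobMod p R) := Module.compHom R ((algebraMap k R).comp (frobenius k p))

/-- The identity of `R`, as an additive equivalence with `FrobMod p R`. -/
def FrobMod.of : R ≃+ FrobMod p R := AddEquiv.refl R

theorem FrobMod.smul_of (r x : R) : r • FrobMod.of p x = FrobMod.of p (r ^ p * x) := rfl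

omit [CharP R p] in
theorem FrobMod.field_smul_of (c : k) (x : R) : c • FrobMod.of p x = FrobMod.of p (c ^ p • x) := by
  rw [Algebra.smul_def]
  rfl

instance : IsScalarTower k R (FrobMod p R) where
  smul_assoc c r x := by
    obtain ⟨x, rfl⟩ := (FrobMod.of p).surjective x
    rw [FrobMod.smul_of, FrobMod.smul_of, FrobMod.field_smul_of, smul_pow, smul_mul_assoc]

omit [CharP k p] in
theorem finite_frobenius (k : Type*) [Field k] [CharP k p] [Algebra k R] [PerfectField k]
    [Algebra.FiniteType k R] : (frobenius R p).Finite := by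
  have hperf : PerfectRing k p := PerfectField.toPerfectRing p
  refine RingHom.IsIntegral.to_finite ?_ ?_
  · intro x
    exact ⟨Polynomial.X ^ p - Polynomial.C x,
      Polynomial.monic_X_pow_sub_C x (Fact.out : p.Prime).ne_zero, by simp [frobenius_def]⟩
  · refine RingHom.FiniteType.of_comp_finiteType (f := algebraMap k R) ?_
    have h : (frobenius R p).comp (algebraMap k R) = (algebraMap k R).comp (frobenius k p) := by
      ext x
      simp [frobenius_def]
    rw [h]
    exact RingHom.FiniteType.comp
      ((RingHom.finiteType_algebraMap (A := k) (B := R)).2 inferInstance)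
      (RingHom.FiniteType.of_surjective _ (surjective_frobenius k p))

theorem finite_frobMod (k : Type*) [Field k] [CharP k p] [Algebra k R] [PerfectField k]
    [Algebra.FiniteType k R] : Module.Finite R (FrobMod p R) :=
  finite_frobenius p k

variable (𝒜 : ℕ → Submodule k R)

/-- The grading of `FrobMod p R`. -/
def frobPiece (j : ℕ) : Submodule k (FrobMod p R) where
  carrier := {x | (FrobMod.of p).symm x ∈ 𝒜 j}
  add_mem' := (𝒜 j).add_mem
  zero_mem' := (𝒜 j).zero_mem
  smul_mem' c x hx := by
    obtain ⟨x, rfl⟩ := (FrobMod.of p).surjective x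
    rw [FrobMod.field_smul_of]
    exact (𝒜 j).smul_mem _ hx

omit [CharP R p] in
theorem mem_frobPiece (j : ℕ) (x : R) : FrobMod.of p x ∈ frobPiece p 𝒜 j ↔ x ∈ 𝒜 j := Iff.rfl

instance [GradedAlgebra 𝒜] : DirectSum.Decomposition (frobPiece p 𝒜) where
  decompose' := fun x => DirectSum.decompose 𝒜 ((FrobMod.of p).symm x)
  left_inv := (inferInstance : DirectSum.Decomposition 𝒜).left_inv
  right_inv := (inferInstance : DirectSum.Decomposition 𝒜).right_inv

theorem smul_mem_frobPiece [GradedAlgebra 𝒜] (a j : ℕ) (r : R) (hr : r ∈ 𝒜 a) (m : FrobMod p R)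
    (hm : m ∈ frobPiece p 𝒜 j) : r • m ∈ frobPiece p 𝒜 (p * a + j) := by
  obtain ⟨m, rfl⟩ := (FrobMod.of p).surjective m
  rw [FrobMod.smul_of, mem_frobPiece]
  exact SetLike.mul_mem_graded (by simpa using SetLike.pow_mem_graded p hr) hm

theorem of_mem_smul_top (J : Ideal R) (x : R) :
    FrobMod.of p x ∈ J • (⊤ : Submodule R (FrobMod p R)) ↔ x ∈ J.map (frobenius R p) := by
  constructor
  · suffices H : ∀ y ∈ J • (⊤ : Submodule R (FrobMod p R)),
        (FrobMod.of p).symm y ∈ J.map (frobenius R p) from H _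
    intro y hy
    refine Submodule.smul_induction_on hy ?_ ?_
    · intro r hr m _
      obtain ⟨m, rfl⟩ := (FrobMod.of p).surjective m
      rw [FrobMod.smul_of, AddEquiv.symm_apply_apply]
      exact Ideal.mul_mem_right _ _ (Ideal.mem_map_of_mem (frobenius R p) hr)
    · intro x y hx hy
      rw [map_add]
      exact Ideal.add_mem _ hx hy
  · intro hx
    suffices H : ∀ y : R, FrobMod.of p (y * x) ∈ J • (⊤ : Submodule R (FrobMod p R)) by
      simpa using H 1
    induction hx using Submodule.span_induction with
    | mem x hx =>
      obtain ⟨r, hr, rfl⟩ := hx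
      intro y
      have h := Submodule.smul_mem_smul (N := (⊤ : Submodule R (FrobMod p R))) hr
        (Submodule.mem_top (x := FrobMod.of p y))
      rwa [FrobMod.smul_of, mul_comm] at h
    | zero => simp
    | add x y _ _ hx hy =>
      intro z
      rw [mul_add, map_add]
      exact Submodule.add_mem _ (hx z) (hy z)
    | smul r x _ hx =>
      intro z
      rw [smul_eq_mul, ← mul_assoc]
      exact hx _

omit [CharP R p] in
theorem relDim_frobPiece [PerfectField k] (j : ℕ) (W : Submodule k R)
    (W' : Submodule k (FrobMod p R)) (h : ∀ x : R, FrobMod.of p x ∈ W' ↔ x ∈ W) :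
    relDim (frobPiece p 𝒜 j) W' = relDim (𝒜 j) W := by
  have hperf : PerfectRing k p := PerfectField.toPerfectRing p
  let e : 𝒜 j ≃+ frobPiece p 𝒜 j := AddEquiv.refl (𝒜 j)
  have he : (W.comap (𝒜 j).subtype).toAddSubgroup.map (e : 𝒜 j →+ frobPiece p 𝒜 j) =
      (W'.comap (frobPiece p 𝒜 j).subtype).toAddSubgroup := by
    ext x
    obtain ⟨x, rfl⟩ := e.surjective x
    constructor
    · rintro ⟨y, hy, hxy⟩
      obtain rfl := e.injective hxy
      exact (h _).2 hy
    · intro hx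
      exact ⟨x, (h _).1 hx, rfl⟩
  let E : (𝒜 j ⧸ W.comap (𝒜 j).subtype) ≃+
      (frobPiece p 𝒜 j ⧸ W'.comap (frobPiece p 𝒜 j).subtype) :=
    QuotientAddGroup.congr _ _ e he
  have hE : ∀ x, E (Submodule.Quotient.mk x) = Submodule.Quotient.mk (e x) := fun _ => rfl
  have hrank := rank_eq_of_equiv_equiv (R := k) (R' := k) (frobenius k p) E.symm
    (bijective_frobenius k p) ?_
  · unfold relDim Module.finrank
    rw [hrank]
  · intro c y
    obtain ⟨y, rfl⟩ := E.surjective y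
    obtain ⟨x, rfl⟩ := Submodule.Quotient.mk_surjective _ y
    rw [E.symm_apply_apply, E.symm_apply_eq, ← Submodule.Quotient.mk_smul, hE, hE,
      ← Submodule.Quotient.mk_smul]
    congr 1
    exact Subtype.ext (FrobMod.field_smul_of p c (x : R))

end FrobMod

section Comparison

variable {k : Type*} [Field k] {R : Type*} [CommRing R] [Algebra k R]
  (𝒜 : ℕ → Submodule k R)

theorem sum_range_mul_add (f : ℕ → ℕ) (n₀ p m : ℕ) :
    ∑ i ∈ Finset.range (p * n₀), f (p * n₀ * m + i) =
      ∑ t ∈ Finset.range p, ∑ i ∈ Finset.range n₀, f (n₀ * (p * m + t) + i) := by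
  suffices H : ∀ s, ∑ i ∈ Finset.range (s * n₀), f (p * n₀ * m + i) =
      ∑ t ∈ Finset.range s, ∑ i ∈ Finset.range n₀, f (n₀ * (p * m + t) + i) from H p
  intro s
  induction s with
  | zero => simp
  | succ s ih =>
    rw [add_mul, one_mul, Finset.sum_range_add, ih, Finset.sum_range_succ]
    congr 1
    refine Finset.sum_congr rfl fun i _ => ?_
    congr 1
    ring

theorem sum_relDim_block {n₀ : ℕ} (hn₀ : 0 < n₀) (hn₀dvd : ∀ m, 0 < m → 𝒜 m ≠ ⊥ → n₀ ∣ m)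
    (J : Submodule k R) (m : ℕ) :
    ∑ i ∈ Finset.range n₀, relDim (𝒜 (n₀ * m + i)) J = relDim (𝒜 (n₀ * m)) J := by
  rw [Finset.sum_eq_single 0]
  · rw [add_zero]
  · intro i hi hi0
    by_cases h : 𝒜 (n₀ * m + i) = ⊥
    · rw [h]
      exact relDim_eq_zero bot_le
    · have := hn₀dvd _ (by omega) h
      rw [Nat.dvd_add_right (dvd_mul_right _ _)] at this
      exact absurd (Nat.le_of_dvd (by omega) this) (by simpa using hi)
  · simp [hn₀]

variable [GradedAlgebra 𝒜] [IsDomain R] [IsNoetherianRing R] [∀ j, FiniteDimensional k (𝒜 j)]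
  {e : ℕ} (hdim : ringKrullDim R = (e + 2 : ℕ)) {μ : ℕ} {B : ℕ → Ideal R}
  (hB : UnifGenerated 𝒜 μ B) {n₀ : ℕ} (hn₀ : 0 < n₀)
  (hn₀dvd : ∀ m, 0 < m → 𝒜 m ≠ ⊥ → n₀ ∣ m)
  (hn₀gcd : ∀ c : ℕ, (∀ m, 0 < m → 𝒜 m ≠ ⊥ → c ∣ m) → c ∣ n₀)

include hdim hB hn₀ hn₀dvd hn₀gcd

theorem unifBound_sum_relDim_smul_top_sub_finrank
    {M : Type*} [AddCommGroup M] [Module R M] [Module k M] [IsScalarTower k R M]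
    [Module.Finite R M] (ℳ : ℕ → Submodule k M) [DirectSum.Decomposition ℳ] {w : ℕ} (hw : 0 < w)
    (hsm : ∀ a j, ∀ r ∈ 𝒜 a, ∀ m ∈ ℳ j, r • m ∈ ℳ (w * a + j)) :
    UnifBound e (fun n m => (∑ i ∈ Finset.range (w * n₀),
        (relDim (ℳ (w * n₀ * m + i)) ((B n • (⊤ : Submodule R M)).restrictScalars k) : ℝ)) -
      Module.finrank R M * relDim (𝒜 (n₀ * m)) ((B n).restrictScalars k)) := by
  classical
  obtain ⟨N, v, b, hv, hspan⟩ := exists_homogeneous_generators (R := R) ℳ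
    (Module.Finite.fg_top (R := R) (M := M)) fun _ _ _ => Submodule.mem_top
  obtain ⟨σ, hli, hcard, a, s, hs, hs0, hsv⟩ := exists_homogeneous_basis 𝒜 ℳ hw hsm hv hspan
  rw [← hcard, Nat.card_eq_fintype_card]
  exact unifBound_sum_relDim_smul_top_sub 𝒜 hdim hB hn₀ hn₀dvd hn₀gcd ℳ hw hsm hv hspan
    (fun i : σ => hv i) hli hs hs0 hsv

omit hB in
theorem unifBound_frobenius_sub [PerfectField k] [Algebra.FiniteType k R] (p : ℕ) [Fact p.Prime]
    [CharP k p] [CharP R p] {μ : ℕ} {f : Fin μ → R} {δ : Fin μ → ℕ} (hf : ∀ i, f i ∈ 𝒜 (δ i)) :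
    UnifBound e (fun n m => (p : ℝ) * relDim (𝒜 (n₀ * (p * m)))
        (((Ideal.span (Set.range f)).frobeniusPow (p ^ (n + 1))).restrictScalars k) -
      Module.finrank R (FrobMod p R) * relDim (𝒜 (n₀ * m))
        (((Ideal.span (Set.range f)).frobeniusPow (p ^ n)).restrictScalars k)) := by
  have hB := unifGenerated_frobeniusPow 𝒜 p hf
  have hfin : Module.Finite R (FrobMod p R) := finite_frobMod p k
  have h1 := unifBound_sum_relDim_smul_top_sub_finrank 𝒜 hdim hB hn₀ hn₀dvd hn₀gcd
    (frobPiece p 𝒜) (Fact.out : p.Prime).pos (smul_mem_frobPiece p 𝒜)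
  have h2 := UnifBound.sum (Finset.range p) fun t _ =>
    (unifBound_relDim_sub 𝒜 hdim hB hn₀dvd hn₀gcd t).comp (n₀ * p) 0 1
  refine (h1.sub h2).congr fun n m => ?_
  set J := (Ideal.span (Set.range f)).frobeniusPow (p ^ n) with hJ
  set J' := (Ideal.span (Set.range f)).frobeniusPow (p ^ (n + 1)) with hJ'
  have h3 : ∀ j, relDim (frobPiece p 𝒜 j)
      ((J • (⊤ : Submodule R (FrobMod p R))).restrictScalars k) =
        relDim (𝒜 j) (J'.restrictScalars k) := fun j => by
    refine relDim_frobPiece p 𝒜 j _ _ fun x => ?_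
    rw [Submodule.restrictScalars_mem, of_mem_smul_top, hJ, ← frobeniusPow_succ]
    rfl
  have h4 : (∑ i ∈ Finset.range (p * n₀),
      (relDim (𝒜 (p * n₀ * m + i)) (J'.restrictScalars k) : ℝ)) =
        ∑ t ∈ Finset.range p, (relDim (𝒜 (n₀ * (p * m + t))) (J'.restrictScalars k) : ℝ) := by
    have h := sum_range_mul_add (fun i => relDim (𝒜 i) (J'.restrictScalars k)) n₀ p m
    simp only [sum_relDim_block 𝒜 hn₀ hn₀dvd] at h
    exact_mod_cast h
  simp only [h3, h4, Finset.sum_sub_distrib, Finset.sum_const, Finset.card_range, nsmul_eq_mul,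
    add_zero]
  simp only [mul_add, mul_assoc]
  ring

end Comparison

section Sequences

theorem exists_tendsto_of_abs_sub_mul_le {a : ℕ → ℝ} {ρ D E : ℝ} (hρ : 0 ≤ ρ) (hD : 0 ≤ D)
    (hE : ∀ n, |a n| ≤ E) (h : ∀ n, |a (n + 1) - ρ * a n| ≤ D * (1 / 2) ^ n) :
    ∃ l, Tendsto a atTop (𝓝 l) := by
  have hE0 : 0 ≤ E := (abs_nonneg _).trans (hE 0)
  rcases lt_trichotomy ρ 1 with hlt | rfl | hgt
  · obtain ⟨σ, hσ, hσ1⟩ := exists_between (max_lt hlt (by norm_num : (1 / 2 : ℝ) < 1))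
    have hσρ := (le_max_left _ _).trans_lt hσ
    have hσ2 := (le_max_right _ _).trans_lt hσ
    have hsub : 0 < σ - ρ := sub_pos.2 hσρ
    have hb : ∀ n, |a n| ≤ (E + D / (σ - ρ)) * σ ^ n := by
      intro n
      induction n with
      | zero => simpa using (hE 0).trans (le_add_of_nonneg_right (by positivity))
      | succ n ih =>
        have h1 : |a (n + 1)| ≤ |a (n + 1) - ρ * a n| + |ρ * a n| := by
          simpa using abs_add_le (a (n + 1) - ρ * a n) (ρ * a n)
        rw [abs_mul, abs_of_nonneg hρ] at h1
        have h2 : D * (1 / 2) ^ n ≤ D * σ ^ n := by gcongr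
        have h3 := mul_le_mul_of_nonneg_left ih hρ
        have h4 : D = D / (σ - ρ) * (σ - ρ) := by field_simp
        have h5 : 0 ≤ E * (σ - ρ) * σ ^ n := by positivity
        rw [pow_succ]
        have h6 : D * σ ^ n = D / (σ - ρ) * (σ - ρ) * σ ^ n := by rw [← h4]
        nlinarith [h n]
    refine ⟨0, squeeze_zero_norm hb ?_⟩
    simpa using (tendsto_pow_atTop_nhds_zero_of_lt_one (hρ.trans hσρ.le) hσ1).const_mul
      (E + D / (σ - ρ))
  · refine cauchySeq_tendsto_of_complete
      (cauchySeq_of_le_geometric (1 / 2) D (by norm_num) fun n => ?_)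
    rw [dist_comm, Real.dist_eq]
    simpa using h n
  · have hb : ∀ t n, |a n| ≤ (ρ⁻¹) ^ t * E + 2 * D * (1 / 2) ^ n := by
      intro t
      induction t with
      | zero =>
        intro n
        have : 0 ≤ 2 * D * (1 / 2 : ℝ) ^ n := by positivity
        simpa using (hE n).trans (le_add_of_nonneg_right this)
      | succ t ih =>
        intro n
        have h1 : ρ * |a n| ≤ |a (n + 1)| + |a (n + 1) - ρ * a n| := by
          have := abs_sub_abs_le_abs_sub (ρ * a n) (a (n + 1))
          rw [abs_mul, abs_of_nonneg hρ, abs_sub_comm] at this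
          linarith
        have h2 := ih (n + 1)
        rw [pow_succ] at h2
        have h3 : |a n| = ρ⁻¹ * (ρ * |a n|) := by field_simp
        have hinv : ρ⁻¹ ≤ 1 := inv_le_one_of_one_le₀ hgt.le
        have hinv0 : 0 ≤ ρ⁻¹ := inv_nonneg.2 hρ
        have h4 : |a n| ≤ ρ⁻¹ * (ρ⁻¹ ^ t * E + 2 * D * (1 / 2) ^ n) := by
          rw [h3]
          refine mul_le_mul_of_nonneg_left ?_ hinv0
          linarith [h n]
        have h5 : ρ⁻¹ * (2 * D * (1 / 2) ^ n) ≤ 2 * D * (1 / 2) ^ n :=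
          mul_le_of_le_one_left (by positivity) hinv
        rw [pow_succ]
        nlinarith
    have hb' : ∀ n, |a n| ≤ 2 * D * (1 / 2) ^ n := by
      intro n
      refine ge_of_tendsto' (x := atTop) ?_ fun t => hb t n
      simpa using ((tendsto_pow_atTop_nhds_zero_of_lt_one (inv_nonneg.2 hρ)
        (inv_lt_one_of_one_lt₀ hgt)).mul_const E).add_const (2 * D * (1 / 2) ^ n)
    refine ⟨0, squeeze_zero_norm hb' ?_⟩
    simpa using (tendsto_pow_atTop_nhds_zero_of_lt_one (by norm_num : (0 : ℝ) ≤ 1 / 2)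
      (by norm_num)).const_mul (2 * D)

theorem tendsto_interpolation {A B t : ℕ → ℝ} {l : ℝ} (hA : Tendsto A atTop (𝓝 l))
    (hB : Tendsto B atTop (𝓝 l)) (ht : ∀ n, |t n| ≤ 1) :
    Tendsto (fun n => (1 - t n) * A n + t n * B n) atTop (𝓝 l) := by
  have h1 : Tendsto (fun n => t n * (B n - A n)) atTop (𝓝 0) := by
    refine squeeze_zero_norm (fun n => ?_) (by simpa using (hB.sub hA).abs)
    rw [norm_mul]
    exact mul_le_of_le_one_left (abs_nonneg _) (ht n)
  simpa using (hA.add h1).congr fun n => by ring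

end Sequences

section Density

variable {p e : ℕ} {L : ℕ → ℕ → ℝ}

theorem floor_mul_pow_add_one_le (hp : 0 < p) (n : ℕ) {x : ℝ} (hx : 0 ≤ x) :
    (⌊x * (p ^ n : ℕ)⌋₊ : ℝ) + 1 ≤ (x + 1) * (p : ℝ) ^ n := by
  have h1 : (1 : ℝ) ≤ (p : ℝ) ^ n := one_le_pow₀ (by exact_mod_cast hp)
  have h2 := Nat.floor_le (a := x * (p ^ n : ℕ)) (by positivity)
  push_cast at h2 ⊢
  linarith

theorem UnifBound.floor (hp : 0 < p) {g : ℕ → ℕ → ℝ} (hg : UnifBound e g) :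
    ∃ C, 0 ≤ C ∧ ∀ n, ∀ x : ℝ, 0 ≤ x →
      |g n ⌊x * (p ^ n : ℕ)⌋₊ / ((p : ℝ) ^ n) ^ e| ≤ C * (x + 1) ^ e := by
  obtain ⟨C, hC, hgC⟩ := hg
  refine ⟨C, hC, fun n x hx => ?_⟩
  have hq : (0 : ℝ) < (p : ℝ) ^ n := by positivity
  rw [abs_div, abs_of_pos (pow_pos hq e), div_le_iff₀ (pow_pos hq e), mul_assoc, ← mul_pow]
  refine (hgC _ _).trans ?_
  gcongr
  exact floor_mul_pow_add_one_le hp n hx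

theorem one_div_pow_le (hp : 2 ≤ p) (n : ℕ) : 1 / (p : ℝ) ^ n ≤ (1 / 2) ^ n := by
  rw [← one_div_pow]
  have : (2 : ℝ) ≤ p := by exact_mod_cast hp
  gcongr

theorem UnifBound.tendsto_floor (hp : 2 ≤ p) {g : ℕ → ℕ → ℝ} (hg : UnifBound e g) {x : ℝ}
    (hx : 0 ≤ x) :
    Tendsto (fun n => g n ⌊x * (p ^ n : ℕ)⌋₊ / ((p : ℝ) ^ n) ^ (e + 1)) atTop (𝓝 0) := by
  obtain ⟨C, hC, hgC⟩ := hg.floor (p := p) (by omega)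
  refine squeeze_zero_norm (a := fun n => C * (x + 1) ^ e * (1 / 2) ^ n) (fun n => ?_) ?_
  · rw [pow_succ, ← div_div, Real.norm_eq_abs, abs_div,
      abs_of_pos (a := (p : ℝ) ^ n) (by positivity), div_eq_mul_one_div]
    exact mul_le_mul (hgC n x hx) (one_div_pow_le hp n) (by positivity) (by positivity)
  · simpa using (tendsto_pow_atTop_nhds_zero_of_lt_one (by norm_num : (0 : ℝ) ≤ 1 / 2)
      (by norm_num)).const_mul (C * (x + 1) ^ e)

theorem abs_sub_le_of_step {C : ℝ} (hC : 0 ≤ C) {f : ℕ → ℝ}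
    (h : ∀ m, |f (m + 1) - f m| ≤ C * ((m : ℝ) + 1) ^ e) (a t : ℕ) :
    |f (a + t) - f a| ≤ t * (C * (((a + t : ℕ) : ℝ) + 1) ^ e) := by
  induction t with
  | zero => simp
  | succ t ih =>
    have h1 : |f (a + (t + 1)) - f a| ≤ |f (a + t + 1) - f (a + t)| + |f (a + t) - f a| := by
      simpa [add_assoc] using abs_add_le (f (a + t + 1) - f (a + t)) (f (a + t) - f a)
    have h2 : C * (((a + t : ℕ) : ℝ) + 1) ^ e ≤ C * (((a + (t + 1) : ℕ) : ℝ) + 1) ^ e := by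
      gcongr
      omega
    have h3 := mul_le_mul_of_nonneg_left h2 (Nat.cast_nonneg (α := ℝ) t)
    have h4 := h (a + t)
    push_cast at *
    linarith

variable (hp : 2 ≤ p) (hstep : UnifBound e fun n m => L n (m + 1) - L n m)
  (hbound : UnifBound (e + 1) L) {r : ℝ} (hr : 0 ≤ r)
  (hfrob : UnifBound e fun n m => p * L (n + 1) (p * m) - r * L n m)

include hp hstep hbound hr hfrob

theorem exists_tendsto_density {x : ℝ} (hx : 0 ≤ x) :
    ∃ l, Tendsto (fun n => L n ⌊x * (p ^ n : ℕ)⌋₊ / ((p : ℝ) ^ n) ^ (e + 1)) atTop (𝓝 l) := by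
  obtain ⟨C, hC, hstepC⟩ := hstep
  obtain ⟨D, hD, hfrobD⟩ := hfrob
  obtain ⟨E, hE, hboundE⟩ := hbound.floor (p := p) (by omega)
  have hp0 : (0 : ℝ) < p := by positivity
  have hp1 : (1 : ℝ) ≤ p := by exact_mod_cast (by omega : 1 ≤ p)
  refine exists_tendsto_of_abs_sub_mul_le (ρ := r / p / (p : ℝ) ^ (e + 1))
    (D := (C * (p : ℝ) ^ (e + 1) + D) * (x + 1) ^ e) (by positivity) (by positivity)
    (fun n => hboundE n x hx) fun n => ?_
  have hq : (0 : ℝ) < (p : ℝ) ^ n := by positivity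
  set m := ⌊x * (p ^ n : ℕ)⌋₊ with hm
  set m' := ⌊x * (p ^ (n + 1) : ℕ)⌋₊ with hm'
  have hmq : ((m : ℝ) + 1) ≤ (x + 1) * (p : ℝ) ^ n := floor_mul_pow_add_one_le (by omega) n hx
  have hmq' : ((m' : ℝ) + 1) ≤ (x + 1) * (p : ℝ) ^ (n + 1) :=
    floor_mul_pow_add_one_le (by omega) (n + 1) hx
  have hdiv : m' / p = m := by
    rw [hm', ← Nat.floor_div_natCast, hm]
    congr 1
    push_cast
    rw [pow_succ]
    field_simp
  have hmod := Nat.mod_lt m' (by omega : p > 0)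
  have hm'eq : p * m + m' % p = m' := by rw [← hdiv, Nat.div_add_mod]
  have h1 := abs_sub_le_of_step (e := e) hC (hstepC (n + 1)) (p * m) (m' % p)
  rw [hm'eq] at h1
  have h2 := hfrobD n m
  have h3 : |L (n + 1) m' - r / p * L n m| ≤
      (C * (p : ℝ) ^ (e + 1) + D) * ((x + 1) * (p : ℝ) ^ n) ^ e := by
    have h4 : |L (n + 1) m' - r / p * L n m| ≤
        |L (n + 1) m' - L (n + 1) (p * m)| + |L (n + 1) (p * m) - r / p * L n m| := by
      simpa using abs_add_le (L (n + 1) m' - L (n + 1) (p * m))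
        (L (n + 1) (p * m) - r / p * L n m)
    have h5 : |L (n + 1) (p * m) - r / p * L n m| ≤ D * ((x + 1) * (p : ℝ) ^ n) ^ e := by
      have h6 : L (n + 1) (p * m) - r / p * L n m = (p * L (n + 1) (p * m) - r * L n m) / p := by
        field_simp
      rw [h6, abs_div, abs_of_pos hp0]
      refine (div_le_self (abs_nonneg _) hp1).trans (h2.trans ?_)
      gcongr
    have h7 : (m' % p : ℕ) * (C * ((m' : ℝ) + 1) ^ e) ≤
        C * (p : ℝ) ^ (e + 1) * ((x + 1) * (p : ℝ) ^ n) ^ e := by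
      have h8 : C * (p : ℝ) ^ (e + 1) * ((x + 1) * (p : ℝ) ^ n) ^ e =
          p * (C * ((x + 1) * (p : ℝ) ^ (n + 1)) ^ e) := by
        rw [pow_succ, pow_succ (p : ℝ) n, mul_pow, mul_pow, mul_pow]
        ring
      rw [h8]
      gcongr
    linarith
  have h9 : L (n + 1) m' / ((p : ℝ) ^ (n + 1)) ^ (e + 1) -
      r / p / (p : ℝ) ^ (e + 1) * (L n m / ((p : ℝ) ^ n) ^ (e + 1)) =
        (L (n + 1) m' - r / p * L n m) / ((p : ℝ) ^ (n + 1)) ^ (e + 1) := by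
    rw [pow_succ (p : ℝ) n, mul_pow]
    field_simp
  rw [h9, abs_div, abs_of_pos (a := ((p : ℝ) ^ (n + 1)) ^ (e + 1)) (by positivity)]
  calc _ ≤ (C * (p : ℝ) ^ (e + 1) + D) * ((x + 1) * (p : ℝ) ^ n) ^ e / ((p : ℝ) ^ n) ^ (e + 1) := by
        gcongr
        omega
    _ = (C * (p : ℝ) ^ (e + 1) + D) * (x + 1) ^ e * (1 / (p : ℝ) ^ n) := by
        rw [mul_pow, pow_succ ((p : ℝ) ^ n)]
        field_simp
    _ ≤ _ := by
        gcongr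
        exact one_div_pow_le hp n

omit hbound hr hfrob in
theorem abs_sub_density_le {F : ℝ → ℝ} (hF : ∀ x : ℝ, 0 ≤ x →
    Tendsto (fun n => L n ⌊x * (p ^ n : ℕ)⌋₊ / ((p : ℝ) ^ n) ^ (e + 1)) atTop (𝓝 (F x))) :
    ∃ C, 0 ≤ C ∧ ∀ x y : ℝ, 0 ≤ x → x ≤ y → |F y - F x| ≤ C * (y + 1) ^ e * (y - x) := by
  obtain ⟨C, hC, hstepC⟩ := hstep
  refine ⟨C, hC, fun x y hx hxy => ?_⟩
  have hy := hx.trans hxy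
  have hlim : Tendsto (fun n : ℕ => C * (y + 1) ^ e * (y - x + (1 / 2) ^ n)) atTop
      (𝓝 (C * (y + 1) ^ e * (y - x + 0))) :=
    ((tendsto_pow_atTop_nhds_zero_of_lt_one (by norm_num) (by norm_num)).const_add _).const_mul _
  rw [add_zero] at hlim
  refine le_of_tendsto_of_tendsto' ((hF y hy).sub (hF x hx)).abs hlim fun n => ?_
  have hq : (0 : ℝ) < (p : ℝ) ^ n := by positivity
  have hle : ⌊x * (p ^ n : ℕ)⌋₊ ≤ ⌊y * (p ^ n : ℕ)⌋₊ := Nat.floor_le_floor (by gcongr)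
  obtain ⟨t, ht⟩ := Nat.exists_eq_add_of_le hle
  have h1 := abs_sub_le_of_step hC (hstepC n) ⌊x * (p ^ n : ℕ)⌋₊ t
  rw [← ht] at h1
  have h2 := floor_mul_pow_add_one_le (p := p) (by omega) n hy
  have h3 : (t : ℝ) ≤ (y - x + 1 / (p : ℝ) ^ n) * (p : ℝ) ^ n := by
    have h4 := Nat.floor_le (a := y * (p ^ n : ℕ)) (by positivity)
    have h5 := Nat.lt_floor_add_one (x * (p ^ n : ℕ))
    rw [ht] at h4
    push_cast at h4 h5
    rw [add_mul, one_div, inv_mul_cancel₀ hq.ne']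
    linarith
  rw [← sub_div, abs_div, abs_of_pos (a := ((p : ℝ) ^ n) ^ (e + 1)) (by positivity),
    div_le_iff₀ (by positivity)]
  calc _ ≤ _ := h1
    _ ≤ ((y - x + 1 / (p : ℝ) ^ n) * (p : ℝ) ^ n) * (C * ((y + 1) * (p : ℝ) ^ n) ^ e) := by
        gcongr
    _ = C * (y + 1) ^ e * (y - x + 1 / (p : ℝ) ^ n) * ((p : ℝ) ^ n) ^ (e + 1) := by
        rw [mul_pow, pow_succ ((p : ℝ) ^ n)]
        ring
    _ ≤ _ := by
        gcongr
        exact one_div_pow_le hp n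

theorem exists_density {N : ℕ} (hvan : ∀ n m, N * p ^ n ≤ m → L n m = 0) :
    ∃ F : ℝ → ℝ, ContinuousOn F (Set.Ici 0) ∧ (∀ x : ℝ, N < x → F x = 0) ∧
      ∀ x : ℝ, 0 ≤ x →
        Tendsto (fun n => L n ⌊x * (p ^ n : ℕ)⌋₊ / ((p : ℝ) ^ n) ^ (e + 1)) atTop (𝓝 (F x)) := by
  have hex : ∀ x : ℝ, ∃ l, 0 ≤ x →
      Tendsto (fun n => L n ⌊x * (p ^ n : ℕ)⌋₊ / ((p : ℝ) ^ n) ^ (e + 1)) atTop (𝓝 l) := by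
    intro x
    by_cases hx : 0 ≤ x
    · obtain ⟨l, hl⟩ := exists_tendsto_density hp hstep hbound hr hfrob hx
      exact ⟨l, fun _ => hl⟩
    · exact ⟨0, fun h => absurd h hx⟩
  choose F hF using hex
  refine ⟨F, ?_, fun x hx => ?_, hF⟩
  · obtain ⟨C, hC, hlip⟩ := abs_sub_density_le hp hstep hF
    have hlip' : ∀ x y X : ℝ, 0 ≤ x → 0 ≤ y → x ≤ X → y ≤ X →
        |F y - F x| ≤ C * (X + 1) ^ e * |y - x| := by
      intro x y X hx hy hxX hyX
      rcases le_total x y with h | h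
      · rw [abs_of_nonneg (sub_nonneg.2 h)]
        refine (hlip x y hx h).trans ?_
        have := sub_nonneg.2 h
        gcongr
      · rw [abs_sub_comm, abs_sub_comm y, abs_of_nonneg (sub_nonneg.2 h)]
        refine (hlip y x hy h).trans ?_
        have := sub_nonneg.2 h
        gcongr
    intro x hx
    rw [ContinuousWithinAt, tendsto_iff_norm_sub_tendsto_zero]
    have hlim : Tendsto (fun y => C * (x + 1 + 1) ^ e * |y - x|) (𝓝[Set.Ici 0] x) (𝓝 0) := by
      have : Tendsto (fun y => C * (x + 1 + 1) ^ e * |y - x|) (𝓝 x)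
          (𝓝 (C * (x + 1 + 1) ^ e * |x - x|)) := Continuous.tendsto (by fun_prop) x
      rw [sub_self, abs_zero, mul_zero] at this
      exact this.mono_left nhdsWithin_le_nhds
    refine squeeze_zero' (Eventually.of_forall fun _ => norm_nonneg _) ?_ hlim
    filter_upwards [self_mem_nhdsWithin,
      nhdsWithin_le_nhds (Iic_mem_nhds (lt_add_one x))] with y hy hyx
    exact hlip' x y (x + 1) hx hy (le_add_of_nonneg_right zero_le_one) hyx
  · have hx0 : 0 ≤ x := (Nat.cast_nonneg N).trans hx.le
    refine tendsto_nhds_unique (hF x hx0) (tendsto_const_nhds.congr fun n => ?_)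
    rw [hvan, zero_div]
    refine Nat.le_floor ?_
    push_cast
    gcongr

omit hbound hr hfrob in
theorem tendsto_interpolated_density {Λ : ℕ → ℕ → ℝ} {c l x : ℝ} (hx : 0 ≤ x)
    (hΛ : UnifBound e fun n m => Λ n m - c * L n m)
    (hl : Tendsto (fun n => L n ⌊x * (p ^ n : ℕ)⌋₊ / ((p : ℝ) ^ n) ^ (e + 1)) atTop (𝓝 l)) :
    Tendsto (fun n => (1 - (x * (p ^ n : ℕ) - ⌊x * (p ^ n : ℕ)⌋₊)) *
        (Λ n ⌊x * (p ^ n : ℕ)⌋₊ / ((p : ℝ) ^ n) ^ (e + 1)) +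
      (x * (p ^ n : ℕ) - ⌊x * (p ^ n : ℕ)⌋₊) *
        (Λ n (⌊x * (p ^ n : ℕ)⌋₊ + 1) / ((p : ℝ) ^ n) ^ (e + 1))) atTop (𝓝 (c * l)) := by
  have hstep' : UnifBound e fun n m => c * (L n (m + 1) - L n m) := by
    obtain ⟨C, hC, h⟩ := hstep
    refine ⟨|c| * C, by positivity, fun n m => ?_⟩
    rw [abs_mul, mul_assoc]
    exact mul_le_mul_of_nonneg_left (h n m) (abs_nonneg _)
  have h2 : UnifBound e fun n m => Λ n (m + 1) - c * L n m := by
    refine ((hΛ.comp 1 1 0).add hstep').congr fun n m => ?_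
    rw [one_mul, add_zero]
    ring
  refine tendsto_interpolation ?_ ?_ fun n => ?_
  · rw [← zero_add (c * l)]
    exact ((hΛ.tendsto_floor hp hx).add (hl.const_mul c)).congr fun n => by ring
  · rw [← zero_add (c * l)]
    exact ((h2.tendsto_floor hp hx).add (hl.const_mul c)).congr fun n => by ring
  · rw [abs_le]
    have h3 := Nat.floor_le (a := x * (p ^ n : ℕ)) (by positivity)
    have h4 := Nat.lt_floor_add_one (x * (p ^ n : ℕ))
    constructor <;> linarith

end Density

section HKDensity

theorem hkStep_div {k : Type*} [Field k] {R M : Type*} [CommRing R] [AddCommGroup M] [Module R M]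
    [Module k M] [Algebra k R] [IsScalarTower k R M] (ℳ : ℕ → Submodule k M) (I : Ideal R)
    (d n₀ n m : ℕ) {p : ℕ} (hp : 0 < p) :
    hkStep k ℳ I d n₀ p n ((m : ℝ) / (p ^ n : ℕ)) =
      (∑ i ∈ Finset.range (1 * n₀), (relDim (ℳ (1 * n₀ * m + i))
        ((I.frobeniusPow (p ^ n) • (⊤ : Submodule R M)).restrictScalars k) : ℝ)) /
          ((p : ℝ) ^ n) ^ (d - 1) := by
  have hq : ((p ^ n : ℕ) : ℝ) ≠ 0 := by positivity
  rw [hkStep, div_mul_cancel₀ _ hq, Nat.floor_natCast, one_mul, mul_comm n₀]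
  rfl

variable {k : Type*} [Field k] {R : Type*} [CommRing R] [Algebra k R]
  (𝒜 : ℕ → Submodule k R) [GradedAlgebra 𝒜] [IsDomain R] [IsNoetherianRing R]
  [∀ j, FiniteDimensional k (𝒜 j)]
  {e : ℕ} (hdim : ringKrullDim R = (e + 2 : ℕ)) {p μ : ℕ} [Fact p.Prime] [CharP R p]
  {f : Fin μ → R} {δ : Fin μ → ℕ} (hf : ∀ i, f i ∈ 𝒜 (δ i)) {n₀ : ℕ} (hn₀ : 0 < n₀)
  (hn₀dvd : ∀ m, 0 < m → 𝒜 m ≠ ⊥ → n₀ ∣ m)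
  (hn₀gcd : ∀ c : ℕ, (∀ m, 0 < m → 𝒜 m ≠ ⊥ → c ∣ m) → c ∣ n₀)

include hdim hf hn₀ hn₀dvd hn₀gcd

omit hn₀ in
theorem unifBound_relDim_succ_sub :
    UnifBound e fun n m => (relDim (𝒜 (n₀ * (m + 1)))
        (((Ideal.span (Set.range f)).frobeniusPow (p ^ n)).restrictScalars k) : ℝ) -
      relDim (𝒜 (n₀ * m))
        (((Ideal.span (Set.range f)).frobeniusPow (p ^ n)).restrictScalars k) :=
  ((unifBound_relDim_sub 𝒜 hdim (unifGenerated_frobeniusPow 𝒜 p hf) hn₀dvd hn₀gcd 1).comp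
    n₀ 0 0).congr fun n m => by simp only [mul_one, add_zero, mul_add]

theorem tendsto_hkStepG {M : Type*} [AddCommGroup M] [Module R M] [Module k M]
    [IsScalarTower k R M] [Module.Finite R M] (ℳ : ℕ → Submodule k M)
    [DirectSum.Decomposition ℳ] [SetLike.GradedSMul 𝒜 ℳ] {l x : ℝ} (hx : 0 ≤ x)
    (hl : Tendsto (fun n => (relDim (𝒜 (n₀ * ⌊x * (p ^ n : ℕ)⌋₊))
        (((Ideal.span (Set.range f)).frobeniusPow (p ^ n)).restrictScalars k) : ℝ) /
          ((p : ℝ) ^ n) ^ (e + 1)) atTop (𝓝 l)) :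
    Tendsto (fun n => hkStepG k ℳ (Ideal.span (Set.range f)) (e + 2) n₀ p n x) atTop
      (𝓝 (Module.finrank R M * l)) := by
  have hp := (Fact.out : p.Prime)
  have h := tendsto_interpolated_density hp.two_le
    (unifBound_relDim_succ_sub 𝒜 hdim hf hn₀dvd hn₀gcd) hx
    (unifBound_sum_relDim_smul_top_sub_finrank 𝒜 hdim (unifGenerated_frobeniusPow 𝒜 p hf) hn₀
      hn₀dvd hn₀gcd ℳ one_pos fun a j r hr m hm => by
        simpa using SetLike.GradedSMul.smul_mem hr hm) hl
  refine h.congr fun n => ?_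
  rw [hkStepG, hkStep_div ℳ _ _ _ _ _ hp.pos]
  have h2 := hkStep_div ℳ (Ideal.span (Set.range f)) (e + 2) n₀ n
    (⌊x * (p ^ n : ℕ)⌋₊ + 1) hp.pos
  push_cast at h2 ⊢
  rw [h2]

theorem exists_hkDensity [CharP k p] [PerfectField k] [Algebra.FiniteType k R]
    [FiniteDimensional k (R ⧸ Ideal.span (Set.range f))] :
    ∃ FR : ℝ → ℝ, ContinuousOn FR (Set.Ici 0) ∧ (∃ C : ℝ, 0 < C ∧ ∀ x : ℝ, C < x → FR x = 0) ∧
      ∀ x : ℝ, 0 ≤ x → Tendsto (fun n => (relDim (𝒜 (n₀ * ⌊x * (p ^ n : ℕ)⌋₊))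
        (((Ideal.span (Set.range f)).frobeniusPow (p ^ n)).restrictScalars k) : ℝ) /
          ((p : ℝ) ^ n) ^ (e + 1)) atTop (𝓝 (FR x)) := by
  obtain ⟨C, hC⟩ := exists_piece_le_frobeniusPow 𝒜 p hf
  have hbound := (unifBound_relDim 𝒜 hdim
    fun n => (Ideal.span (Set.range f)).frobeniusPow (p ^ n)).comp n₀ 0 0
  simp only [add_zero] at hbound
  obtain ⟨FR, hcont, hvan, hlim⟩ := exists_density (N := C) (Fact.out : p.Prime).two_le
    (unifBound_relDim_succ_sub 𝒜 hdim hf hn₀dvd hn₀gcd) hbound (Nat.cast_nonneg _)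
    (unifBound_frobenius_sub 𝒜 hdim hn₀ hn₀dvd hn₀gcd p hf) fun n m hm => by
      rw [relDim_eq_zero (hC n _ (hm.trans (Nat.le_mul_of_pos_left _ hn₀))), Nat.cast_zero]
  exact ⟨FR, hcont, ⟨C + 1, by positivity, fun x hx => hvan x (by linarith)⟩, hlim⟩

end HKDensity

/-- For a graded pair `(R, I)` of dimension `d ≥ 2` and a finitely
generated graded `R`-module `M`, the HK density function `f_{M_R, I}` exists, is a
compactly supported continuous function on `[0, ∞)`, and equals `rank_R M · f_{R, I}`. -/
theorem statement1
    (k : Type*) [Field k] [PerfectField k] (p : ℕ) [Fact p.Prime] [CharP k p]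
    (R : Type*) [CommRing R] [IsDomain R] [IsNoetherianRing R] [Algebra k R]
    [Algebra.FiniteType k R]
    (𝒜 : ℕ → Submodule k R) [GradedAlgebra 𝒜]
    (h𝒜0 : 𝒜 0 ≤ Submodule.span k {1})
    (d : ℕ) (hd : 2 ≤ d) (hdim : ringKrullDim R = d)
    (I : Ideal R) (hI : I.IsHomogeneous 𝒜) (hIcolen : FiniteDimensional k (R ⧸ I))
    (n₀ : ℕ) (hn₀pos : 0 < n₀)
    (hn₀dvd : ∀ m, 0 < m → 𝒜 m ≠ ⊥ → n₀ ∣ m)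
    (hn₀gcd : ∀ c : ℕ, (∀ m, 0 < m → 𝒜 m ≠ ⊥ → c ∣ m) → c ∣ n₀)
    (M : Type*) [AddCommGroup M] [Module R M] [Module k M] [IsScalarTower k R M]
    [Module.Finite R M]
    (ℳ : ℕ → Submodule k M) [DirectSum.Decomposition ℳ] [SetLike.GradedSMul 𝒜 ℳ] :
    ∃ F FR : ℝ → ℝ,
      (∀ x : ℝ, 0 ≤ x →
        Tendsto (fun n => hkStepG k ℳ I d n₀ p n x) atTop (𝓝 (F x))) ∧
      (∀ x : ℝ, 0 ≤ x →
        Tendsto (fun n => hkStepG k 𝒜 I d n₀ p n x) atTop (𝓝 (FR x))) ∧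
      ContinuousOn F (Set.Ici 0) ∧
      (∃ C : ℝ, 0 < C ∧ ∀ x : ℝ, C < x → F x = 0) ∧
      (∀ x : ℝ, 0 ≤ x →
        F x = (Module.finrank (FractionRing R) (TensorProduct R (FractionRing R) M) : ℝ)
          * FR x) := by
  obtain ⟨e, rfl⟩ := Nat.exists_eq_add_of_le' hd
  have hchar : CharP R p := charP_of_injective_algebraMap (algebraMap k R).injective p
  obtain ⟨μ, f, δ, hf, rfl⟩ := exists_homogeneous_generators (R := R) 𝒜
    (IsNoetherian.noetherian I) fun x hx j => hI j hx
  have hfin := finiteDimensional_piece 𝒜 h𝒜0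
  obtain ⟨FR, hcont, ⟨C, hC0, hC⟩, hlim⟩ :=
    exists_hkDensity 𝒜 hdim (p := p) hf hn₀pos hn₀dvd hn₀gcd
  have hrank : Module.finrank (FractionRing R) (TensorProduct R (FractionRing R) M) =
      Module.finrank R M :=
    (TensorProduct.isBaseChange R M (FractionRing R)).finrank_eq
  refine ⟨fun x => Module.finrank R M * FR x, FR, fun x hx => ?_, fun x hx => ?_,
    continuousOn_const.mul hcont, ⟨C, hC0, fun x hx => by simp [hC x hx]⟩,
    fun x _ => by rw [hrank]⟩
  · exact tendsto_hkStepG 𝒜 hdim hf hn₀pos hn₀dvd hn₀gcd ℳ hx (hlim x hx)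
  · simpa using! tendsto_hkStepG 𝒜 hdim hf hn₀pos hn₀dvd hn₀gcd 𝒜 hx (hlim x hx)
end
end

section
/- Let (R, I) be a graded pair of dimension d ≥ 2 and M a finitely generated graded R-module. Then e_HK(M, I) = ∫₀^∞ f_{M_R,I}(x) dx, i.e., the Hilbert–Kunz multiplicity of M with respect to I equals the integral over [0,∞) of the HK density function of (M_R, I). -/
open Filter MeasureTheory Topology

noncomputable section

/-- An injective integral extension does not lower the Krull dimension. -/
theorem ringKrullDim_le_of_isIntegral_of_faithfulSMul (S R : Type*) [CommRing S] [CommRing R]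
    [Algebra S R] [Algebra.IsIntegral S R] [FaithfulSMul S R] :
    ringKrullDim S ≤ ringKrullDim R := by
  refine iSup_le fun l => ?_
  obtain ⟨P, hP⟩ := Algebra.IsIntegral.comap_surjective S R l.head
  have : P.asIdeal.LiesOver l.head.asIdeal := ⟨by rw [← hP]; rfl⟩
  obtain ⟨L, hL, -⟩ := Ideal.exists_ltSeries_of_hasGoingUp l P.asIdeal
  rw [← hL]
  exact le_iSup (fun L : LTSeries (PrimeSpectrum R) => (L.length : WithBot ℕ∞)) L

/-- Polynomials of total degree at most `N` in `s` variables form a space of dimension at most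
`(N + 1) ^ s`. -/
theorem MvPolynomial.finrank_restrictTotalDegree_le (k : Type*) [Field k] (s N : ℕ) :
    Module.finrank k (MvPolynomial.restrictTotalDegree (Fin s) k N) ≤ (N + 1) ^ s := by
  refine (Submodule.finrank_mono
    (MvPolynomial.restrictTotalDegree_le_restrictDegree (σ := Fin s) k N)).trans ?_
  refine (Module.finrank_eq_nat_card_basis
    (MvPolynomial.basisRestrictSupport k {n : Fin s →₀ ℕ | ∀ i, n i ≤ N})).trans_le ?_
  have hinj : Function.Injective (fun (f : {n : Fin s →₀ ℕ | ∀ i, n i ≤ N}) (i : Fin s) =>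
      (⟨f.1 i, Nat.lt_succ_of_le (f.2 i)⟩ : Fin (N + 1))) := by
    intro f g h
    ext i
    simpa using congrFun h i
  simpa using Nat.card_le_card_of_injective _ hinj

theorem Submodule.finrank_mul_le_mul {k R : Type*} [Field k] [CommRing R] [Algebra k R]
    (A B : Submodule k R) [FiniteDimensional k A] [FiniteDimensional k B] :
    Module.finrank k ↥(A * B) ≤ Module.finrank k A * Module.finrank k B := by
  rw [← Submodule.mulMap_range, ← Module.finrank_tensorProduct]
  exact LinearMap.finrank_range_le _

/-- A finitely generated submodule contained elementwise in an increasing union is contained in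
one of the members. -/
theorem Submodule.FG.exists_le_of_monotone {k M : Type*} [Semiring k] [AddCommMonoid M]
    [Module k M] {K : Submodule k M} (hK : K.FG) {W : ℕ → Submodule k M} (hW : Monotone W)
    (h : ∀ x ∈ K, ∃ n, x ∈ W n) : ∃ n, K ≤ W n := by
  classical
  obtain ⟨S, rfl⟩ := hK
  choose! f hf using h
  refine ⟨S.sup f, Submodule.span_le.mpr fun x hx => ?_⟩
  exact hW (Finset.le_sup (f := f) hx) (hf x (Submodule.subset_span hx))

/-- Powers of a finite-dimensional subspace of a `d`-dimensional finitely generated algebra grow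
at most like a polynomial of degree `d`. -/
theorem exists_finrank_pow_le (k : Type*) [Field k] {R : Type*} [CommRing R] [Nontrivial R]
    [Algebra k R] [Algebra.FiniteType k R] {d : ℕ} (hdim : ringKrullDim R = d)
    (V : Submodule k R) (hV : V.FG) :
    ∃ C : ℕ, ∀ j : ℕ, Module.finrank k ↥(V ^ j) ≤ C * (j + 1) ^ d := by
  classical
  obtain ⟨s, g, ginj, gfin⟩ := exists_finite_inj_algHom_of_fg k R
  replace gfin : g.toRingHom.Finite := gfin
  have hs : s ≤ d := by
    algebraize [g.toRingHom]
    have : FaithfulSMul (MvPolynomial (Fin s) k) R :=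
      (faithfulSMul_iff_algebraMap_injective _ _).mpr ginj
    have := ringKrullDim_le_of_isIntegral_of_faithfulSMul (MvPolynomial (Fin s) k) R
    rw [hdim, MvPolynomial.ringKrullDim_of_isNoetherianRing, ringKrullDim_eq_zero_of_field] at this
    simpa using this
  obtain ⟨S, hS⟩ : ∃ S : Finset R, ∀ r : R, ∃ c : R → MvPolynomial (Fin s) k,
      r = ∑ w ∈ S, g (c w) * w := by
    algebraize [g.toRingHom]
    obtain ⟨S, hS⟩ := (Module.Finite.fg_top : (⊤ : Submodule (MvPolynomial (Fin s) k) R).FG)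
    refine ⟨S, fun r => ?_⟩
    obtain ⟨c, -, hc⟩ := Submodule.mem_span_finset.mp (hS ▸ Submodule.mem_top : r ∈ _)
    exact ⟨c, by rw [← hc]; rfl⟩
  let T : ℕ → Submodule k R := fun N =>
    (MvPolynomial.restrictTotalDegree (Fin s) k N).map g.toLinearMap
  let U : Submodule k R := Submodule.span k S
  have hTmono : Monotone T := fun a b hab => Submodule.map_mono fun p hp => by
    rw [MvPolynomial.mem_restrictTotalDegree] at hp ⊢
    exact hp.trans hab
  have hTmul : ∀ a b, T a * T b ≤ T (a + b) := fun a b => by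
    refine Submodule.mul_le.mpr ?_
    rintro _ ⟨p, hp, rfl⟩ _ ⟨q, hq, rfl⟩
    refine ⟨p * q, ?_, map_mul g p q⟩
    simp only [SetLike.mem_coe, MvPolynomial.mem_restrictTotalDegree] at hp hq ⊢
    exact (MvPolynomial.totalDegree_mul p q).trans (add_le_add hp hq)
  have hWmono : Monotone fun N => T N * U := fun a b hab => mul_le_mul_left (hTmono hab) U
  have hWtop : ∀ r : R, ∃ N, r ∈ T N * U := fun r => by
    obtain ⟨c, rfl⟩ := hS r
    refine ⟨S.sup fun w => (c w).totalDegree, Submodule.sum_mem _ fun w hw => ?_⟩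
    refine Submodule.mul_mem_mul ⟨c w, ?_, rfl⟩ (Submodule.subset_span hw)
    simp only [SetLike.mem_coe, MvPolynomial.mem_restrictTotalDegree]
    exact Finset.le_sup (f := fun w => (c w).totalDegree) hw
  have hU : U.FG := ⟨S, rfl⟩
  obtain ⟨D₁, hD₁⟩ := (hV.mul hU).exists_le_of_monotone hWmono fun x _ => hWtop x
  obtain ⟨D₂, hD₂⟩ := hWtop 1
  have hpow : ∀ j, V ^ j ≤ T (D₁ * j + D₂) * U := by
    intro j
    induction j with
    | zero => simpa [Submodule.one_le] using hD₂
    | succ j ih =>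
      calc V ^ (j + 1) = V ^ j * V := pow_succ V j
        _ ≤ T (D₁ * j + D₂) * U * V := mul_le_mul_left ih V
        _ = T (D₁ * j + D₂) * (V * U) := by rw [mul_assoc, mul_comm U]
        _ ≤ T (D₁ * j + D₂) * (T D₁ * U) := mul_le_mul_right hD₁ _
        _ = T (D₁ * j + D₂) * T D₁ * U := (mul_assoc _ _ _).symm
        _ ≤ T (D₁ * j + D₂ + D₁) * U := mul_le_mul_left (hTmul _ _) U
        _ = T (D₁ * (j + 1) + D₂) * U := by congr 2; ring
  have hUfin : FiniteDimensional k U := Module.Finite.iff_fg.mpr hU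
  refine ⟨(D₁ + D₂ + 1) ^ d * Module.finrank k U, fun j => ?_⟩
  have hTU : FiniteDimensional k ↥(T (D₁ * j + D₂) * U) :=
    Module.Finite.iff_fg.mpr ((Module.Finite.iff_fg.mp inferInstance).mul hU)
  calc Module.finrank k ↥(V ^ j) ≤ Module.finrank k ↥(T (D₁ * j + D₂) * U) :=
        Submodule.finrank_mono (hpow j)
    _ ≤ Module.finrank k (T (D₁ * j + D₂)) * Module.finrank k U := Submodule.finrank_mul_le_mul _ _
    _ ≤ (D₁ * j + D₂ + 1) ^ s * Module.finrank k U := by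
        gcongr
        exact (Submodule.finrank_map_le _ _).trans
          (MvPolynomial.finrank_restrictTotalDegree_le k s _)
    _ ≤ (D₁ * j + D₂ + 1) ^ d * Module.finrank k U := by
        gcongr
        omega
    _ ≤ ((D₁ + D₂ + 1) * (j + 1)) ^ d * Module.finrank k U := by
        gcongr
        nlinarith
    _ = (D₁ + D₂ + 1) ^ d * Module.finrank k U * (j + 1) ^ d := by rw [mul_pow]; ring

section GradedProj

variable {k M : Type*} [Field k] [AddCommGroup M] [Module k M]
  (ℳ : ℕ → Submodule k M) [DirectSum.Decomposition ℳ]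

/-- The projection onto the degree-`j` component, as an endomorphism of the graded space. -/
def gradedProj (j : ℕ) : M →ₗ[k] M :=
  (ℳ j).subtype ∘ₗ DirectSum.component k ℕ (fun i => ℳ i) j ∘ₗ
    (DirectSum.decomposeLinearEquiv ℳ).toLinearMap

theorem gradedProj_apply (j : ℕ) (m : M) :
    gradedProj ℳ j m = (DirectSum.decompose ℳ m j : M) := rfl

theorem gradedProj_mem (j : ℕ) (m : M) : gradedProj ℳ j m ∈ ℳ j :=
  (DirectSum.decompose ℳ m j).2

theorem gradedProj_of_mem {j : ℕ} {m : M} (hm : m ∈ ℳ j) : gradedProj ℳ j m = m :=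
  DirectSum.decompose_of_mem_same ℳ hm

theorem gradedProj_of_mem_ne {i j : ℕ} {m : M} (hm : m ∈ ℳ i) (hij : i ≠ j) :
    gradedProj ℳ j m = 0 :=
  DirectSum.decompose_of_mem_ne ℳ hm hij

theorem exists_finset_sum_gradedProj (m : M) :
    ∃ s : Finset ℕ, ∑ i ∈ s, gradedProj ℳ i m = m ∧ ∀ i ∉ s, gradedProj ℳ i m = 0 := by
  classical
  refine ⟨(DirectSum.decompose ℳ m).support, DirectSum.sum_support_decompose ℳ m, fun i hi => ?_⟩
  rw [gradedProj_apply, DFinsupp.notMem_support_iff.mp hi, ZeroMemClass.coe_zero]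

end GradedProj


section Graded

variable {k R M : Type*} [Field k] [CommRing R] [Algebra k R]
  (𝒜 : ℕ → Submodule k R) [GradedAlgebra 𝒜]
  [AddCommGroup M] [Module R M] [Module k M]
  (ℳ : ℕ → Submodule k M) [DirectSum.Decomposition ℳ] [SetLike.GradedSMul 𝒜 ℳ]

theorem gradedProj_smul_mem (K : Submodule k M) (r : R) (m : M) (j : ℕ)
    (h : ∀ i l, i + l = j → gradedProj 𝒜 i r • gradedProj ℳ l m ∈ K) :
    gradedProj ℳ j (r • m) ∈ K := by
  obtain ⟨s, hs, -⟩ := exists_finset_sum_gradedProj 𝒜 r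
  obtain ⟨t, ht, -⟩ := exists_finset_sum_gradedProj ℳ m
  have hrm : r • m = ∑ i ∈ s, ∑ l ∈ t, gradedProj 𝒜 i r • gradedProj ℳ l m := by
    rw [← Finset.sum_smul_sum, hs, ht]
  rw [hrm, map_sum]
  refine Submodule.sum_mem _ fun i _ => ?_
  rw [map_sum]
  refine Submodule.sum_mem _ fun l _ => ?_
  have hmem : gradedProj 𝒜 i r • gradedProj ℳ l m ∈ ℳ (i + l) :=
    SetLike.GradedSMul.smul_mem (gradedProj_mem 𝒜 i r) (gradedProj_mem ℳ l m)
  by_cases hil : i + l = j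
  · rw [gradedProj_of_mem ℳ (hil ▸ hmem)]
    exact h i l hil
  · rw [gradedProj_of_mem_ne ℳ hmem hil]
    exact K.zero_mem

variable [IsScalarTower k R M]

theorem gradedProj_mem_smul_top {J : Ideal R} (hJ : J.IsHomogeneous 𝒜) {m : M}
    (hm : m ∈ J • (⊤ : Submodule R M)) (j : ℕ) :
    gradedProj ℳ j m ∈ J • (⊤ : Submodule R M) := by
  refine Submodule.smul_induction_on (p := fun m => gradedProj ℳ j m ∈ J • (⊤ : Submodule R M)) hm
    (fun r hr m _ => ?_) fun x y hx hy => ?_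
  · rw [← Submodule.restrictScalars_mem k]
    refine gradedProj_smul_mem 𝒜 ℳ _ r m j fun i l _ => ?_
    rw [Submodule.restrictScalars_mem]
    exact Submodule.smul_mem_smul (hJ i hr) Submodule.mem_top
  · rw [map_add]
    exact Submodule.add_mem _ hx hy

/-- A finitely generated graded algebra with `𝒜 0 = k` is generated by finitely many homogeneous
elements of positive degree. -/
theorem exists_finset_adjoin_eq_top_of_pos_degree [Algebra.FiniteType k R]
    (h𝒜0 : 𝒜 0 ≤ Submodule.span k {1}) :
    ∃ S : Finset R, Algebra.adjoin k (S : Set R) = ⊤ ∧ ∀ x ∈ S, ∃ n, 0 < n ∧ x ∈ 𝒜 n := by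
  classical
  obtain ⟨F, hF⟩ := Algebra.FiniteType.out (R := k) (A := R)
  choose s hs _ using exists_finset_sum_gradedProj 𝒜
  refine ⟨F.biUnion fun x => ((s x).filter (0 < ·)).image fun i => gradedProj 𝒜 i x, ?_, ?_⟩
  · rw [← top_le_iff, ← hF, Algebra.adjoin_le_iff]
    intro x hx
    rw [SetLike.mem_coe, ← hs x]
    refine sum_mem fun i hi => ?_
    rcases Nat.eq_zero_or_pos i with rfl | hi0
    · obtain ⟨c, hc⟩ := Submodule.mem_span_singleton.mp (h𝒜0 (gradedProj_mem 𝒜 0 x))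
      rw [← hc]
      exact Subalgebra.smul_mem _ (one_mem _) c
    · refine Algebra.subset_adjoin ?_
      simp only [Finset.coe_biUnion, Set.mem_iUnion, Finset.mem_coe, Finset.mem_image,
        Finset.mem_filter]
      exact ⟨x, hx, i, ⟨hi, hi0⟩, rfl⟩
  · intro y hy
    simp only [Finset.mem_biUnion, Finset.mem_image, Finset.mem_filter] at hy
    obtain ⟨x, -, i, ⟨-, hi⟩, rfl⟩ := hy
    exact ⟨i, hi, gradedProj_mem 𝒜 i x⟩

theorem graded_le_span_pow {S : Finset R} (hS : Algebra.adjoin k (S : Set R) = ⊤)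
    (hdeg : ∀ x ∈ S, ∃ n, 0 < n ∧ x ∈ 𝒜 n) (j : ℕ) :
    𝒜 j ≤ Submodule.span k (insert 1 (S : Set R)) ^ j := by
  set V := Submodule.span k (insert 1 (S : Set R))
  have h1V : (1 : Submodule k R) ≤ V :=
    Submodule.one_le.mpr (Submodule.subset_span (Set.mem_insert _ _))
  suffices h : ∀ r ∈ Algebra.adjoin k (S : Set R), ∀ j,
      gradedProj 𝒜 j r ∈ V ^ j by
    intro r hr
    simpa [gradedProj_of_mem 𝒜 hr] using h r (hS ▸ Algebra.mem_top) j
  intro r hr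
  induction hr using Algebra.adjoin_induction with
  | mem x hx =>
    intro j
    obtain ⟨n, hn, hxn⟩ := hdeg x hx
    by_cases hnj : n = j
    · subst hnj
      rw [gradedProj_of_mem 𝒜 hxn]
      obtain ⟨n, rfl⟩ := Nat.exists_eq_succ_of_ne_zero hn.ne'
      rw [pow_succ, ← one_mul x]
      exact Submodule.mul_mem_mul (Submodule.one_le.mp (one_le_pow₀ h1V))
        (Submodule.subset_span (Set.mem_insert_of_mem _ hx))
    · rw [gradedProj_of_mem_ne 𝒜 hxn hnj]
      exact zero_mem _
  | algebraMap c =>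
    intro j
    have hc : algebraMap k R c ∈ 𝒜 0 := SetLike.algebraMap_mem_graded 𝒜 c
    by_cases hj : 0 = j
    · subst hj
      rw [gradedProj_of_mem 𝒜 hc, pow_zero]
      exact Submodule.algebraMap_mem c
    · rw [gradedProj_of_mem_ne 𝒜 hc hj]
      exact zero_mem _
  | add x y _ _ hx hy =>
    intro j
    rw [map_add]
    exact add_mem (hx j) (hy j)
  | mul x y _ _ hx hy =>
    intro j
    refine gradedProj_smul_mem 𝒜 𝒜 (V ^ j) x y j ?_
    rintro i l rfl
    rw [pow_add]
    exact Submodule.mul_mem_mul (hx i) (hy l)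

/-- The Hilbert function of a graded domain of dimension `d` with `𝒜 0 = k` grows at most like a
polynomial of degree `d - 1`. -/
theorem exists_finrank_graded_le [IsDomain R] [Algebra.FiniteType k R]
    (h𝒜0 : 𝒜 0 ≤ Submodule.span k {1}) {d : ℕ} (hd : 0 < d) (hdim : ringKrullDim R = d) :
    (∀ j, FiniteDimensional k (𝒜 j)) ∧
      ∃ C : ℕ, ∀ j, Module.finrank k (𝒜 j) ≤ C * (j + 1) ^ (d - 1) := by
  classical
  obtain ⟨S, hS, hdeg⟩ := exists_finset_adjoin_eq_top_of_pos_degree 𝒜 h𝒜0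
  set V := Submodule.span k (insert 1 (S : Set R)) with hVdef
  have hVfg : V.FG := ⟨insert 1 S, by simp [hVdef]⟩
  have h1V : (1 : Submodule k R) ≤ V :=
    Submodule.one_le.mpr (Submodule.subset_span (Set.mem_insert _ _))
  have hle := graded_le_span_pow 𝒜 hS hdeg
  have hVfin : ∀ j, FiniteDimensional k ↥(V ^ j) := fun j => Module.Finite.iff_fg.mpr (hVfg.pow j)
  have hfin : ∀ j, FiniteDimensional k (𝒜 j) := fun j =>
    Submodule.finiteDimensional_of_le (hle j)
  obtain ⟨C, hC⟩ := exists_finrank_pow_le k hdim V hVfg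
  obtain ⟨t, htS, ht0⟩ : ∃ t ∈ S, t ≠ 0 := by
    by_contra! h
    have hbot : Algebra.adjoin k (S : Set R) = ⊥ :=
      le_bot_iff.mp (Algebra.adjoin_le fun x hx => by
        rw [h x hx]
        exact zero_mem _)
    have hsurj : Function.Surjective (algebraMap k R) :=
      Algebra.surjective_algebraMap_iff.mpr (hS.symm.trans hbot)
    have := ringKrullDim_le_of_surjective _ hsurj
    rw [hdim, ringKrullDim_eq_zero_of_field] at this
    have : d ≤ 0 := by exact_mod_cast this
    omega
  obtain ⟨e, he, hte⟩ := hdeg t htS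
  refine ⟨hfin, C * (e + 2) ^ d, fun j => ?_⟩
  have hmem : ∀ (i : ℕ) (a : 𝒜 j), t ^ i * a ∈ 𝒜 (i * e + j) := fun i a => by
    have := SetLike.pow_mem_graded i hte
    rw [smul_eq_mul] at this
    exact SetLike.mul_mem_graded this a.2
  have hmemV : ∀ (i : Fin (j + 1)) (a : 𝒜 j), t ^ (i : ℕ) * a ∈ V ^ ((e + 1) * (j + 1)) :=
    fun i a => by
      have hi : (i : ℕ) * e + j ≤ (e + 1) * (j + 1) := by nlinarith [i.2]
      exact pow_le_pow_right₀ h1V hi (hle _ (hmem i a))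
  let φ : (Fin (j + 1) → 𝒜 j) →ₗ[k] R :=
    ∑ i : Fin (j + 1), (LinearMap.mulLeft k (t ^ (i : ℕ))) ∘ₗ (𝒜 j).subtype ∘ₗ
      LinearMap.proj (φ := fun _ : Fin (j + 1) => 𝒜 j) i
  have hφ : ∀ a, φ a = ∑ i : Fin (j + 1), t ^ (i : ℕ) * (a i : R) := fun a => by simp [φ]
  have hinj : Function.Injective φ := by
    rw [injective_iff_map_eq_zero]
    intro a ha
    ext i
    have h0 : gradedProj 𝒜 ((i : ℕ) * e + j) (φ a) = 0 := by
      rw [ha]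
      simp
    rw [hφ, map_sum, Finset.sum_eq_single i] at h0
    · rw [gradedProj_of_mem 𝒜 (hmem i (a i))] at h0
      simpa [ht0] using h0
    · intro l _ hli
      refine gradedProj_of_mem_ne 𝒜 (hmem l (a l)) fun h => hli (Fin.ext ?_)
      exact Nat.eq_of_mul_eq_mul_right he (Nat.add_right_cancel h)
    · simp
  have hrange : LinearMap.range φ ≤ V ^ ((e + 1) * (j + 1)) := by
    rintro _ ⟨a, rfl⟩
    rw [hφ]
    exact Submodule.sum_mem _ fun (i : Fin (j + 1)) _ => hmemV i (a i)
  have h1 : (j + 1) * Module.finrank k (𝒜 j) ≤ C * ((e + 1) * (j + 1) + 1) ^ d := by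
    calc (j + 1) * Module.finrank k (𝒜 j) = Module.finrank k (Fin (j + 1) → 𝒜 j) := by
          simp [Module.finrank_pi_fintype]
      _ = Module.finrank k (LinearMap.range φ) := (LinearMap.finrank_range_of_inj hinj).symm
      _ ≤ Module.finrank k ↥(V ^ ((e + 1) * (j + 1))) := Submodule.finrank_mono hrange
      _ ≤ _ := hC _
  refine Nat.le_of_mul_le_mul_left (h1.trans ?_) j.succ_pos
  obtain ⟨d, rfl⟩ := Nat.exists_eq_succ_of_ne_zero hd.ne'
  calc C * ((e + 1) * (j + 1) + 1) ^ (d + 1) ≤ C * ((e + 2) * (j + 1)) ^ (d + 1) := by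
        gcongr
        nlinarith
    _ = (j + 1) * (C * (e + 2) ^ (d + 1) * (j + 1) ^ d) := by rw [mul_pow]; ring

/-- A finitely generated graded module is generated by finitely many homogeneous elements: every
graded piece is a finite sum of shifted graded pieces of the ring. -/
theorem exists_finset_graded_le_sup [Module.Finite R M] :
    ∃ T : Finset (ℕ × M), (∀ t ∈ T, t.2 ∈ ℳ t.1) ∧ ∀ j, ℳ j ≤
      (T.filter (·.1 ≤ j)).sup fun t =>
        (𝒜 (j - t.1)).map ((LinearMap.toSpanSingleton R M t.2).restrictScalars k) := by
  classical
  obtain ⟨S, hS⟩ := (Module.Finite.fg_top : (⊤ : Submodule R M).FG)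
  choose s hs hs0 using exists_finset_sum_gradedProj ℳ
  refine ⟨S.biUnion fun x => (s x).image fun i => (i, gradedProj ℳ i x), ?_, fun j m hm => ?_⟩
  · intro t ht
    simp only [Finset.mem_biUnion, Finset.mem_image] at ht
    obtain ⟨x, -, i, -, rfl⟩ := ht
    exact gradedProj_mem ℳ i x
  · obtain ⟨c, -, hc⟩ := Submodule.mem_span_finset.mp (hS ▸ Submodule.mem_top : m ∈ _)
    rw [← gradedProj_of_mem ℳ hm, ← hc, map_sum]
    refine Submodule.sum_mem _ fun x hx => gradedProj_smul_mem 𝒜 ℳ _ (c x) x j ?_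
    rintro i l rfl
    by_cases hl : l ∈ s x
    · refine Finset.le_sup (f := fun t : ℕ × M => (𝒜 (i + l - t.1)).map
        ((LinearMap.toSpanSingleton R M t.2).restrictScalars k)) (b := (l, gradedProj ℳ l x)) ?_ ?_
      · simp only [Finset.mem_filter, Finset.mem_biUnion, Finset.mem_image]
        exact ⟨⟨x, hx, l, hl, rfl⟩, Nat.le_add_left _ _⟩
      · refine ⟨gradedProj 𝒜 i (c x), ?_, rfl⟩
        simpa using gradedProj_mem 𝒜 i (c x)
    · rw [hs0 x l hl, smul_zero]
      exact zero_mem _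

theorem Submodule.finrank_finset_sup_le {ι k M : Type*} [Field k] [AddCommGroup M] [Module k M]
    (T : Finset ι) (f : ι → Submodule k M) (hf : ∀ i ∈ T, FiniteDimensional k (f i)) :
    FiniteDimensional k ↥(T.sup f) ∧
      Module.finrank k ↥(T.sup f) ≤ ∑ i ∈ T, Module.finrank k (f i) := by
  classical
  induction T using Finset.induction_on with
  | empty =>
    rw [Finset.sup_empty]
    exact ⟨inferInstance, by simp⟩
  | insert a T ha ih =>
    obtain ⟨h1, h2⟩ := ih fun i hi => hf i (Finset.mem_insert_of_mem hi)
    have := hf a (Finset.mem_insert_self a T)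
    rw [Finset.sup_insert, Finset.sum_insert ha]
    exact ⟨inferInstance,
      (Submodule.finrank_add_le_finrank_add_finrank _ _).trans (Nat.add_le_add_left h2 _)⟩

theorem exists_finrank_graded_module_le [IsDomain R] [Algebra.FiniteType k R] [Module.Finite R M]
    (h𝒜0 : 𝒜 0 ≤ Submodule.span k {1}) {d : ℕ} (hd : 0 < d) (hdim : ringKrullDim R = d) :
    (∀ j, FiniteDimensional k (ℳ j)) ∧
      ∃ C : ℕ, ∀ j, Module.finrank k (ℳ j) ≤ C * (j + 1) ^ (d - 1) := by
  obtain ⟨T, -, hT⟩ := exists_finset_graded_le_sup 𝒜 ℳ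
  obtain ⟨hfin, C, hC⟩ := exists_finrank_graded_le 𝒜 h𝒜0 hd hdim
  have hsup := fun j => Submodule.finrank_finset_sup_le (T.filter (·.1 ≤ j)) (fun t =>
    (𝒜 (j - t.1)).map ((LinearMap.toSpanSingleton R M t.2).restrictScalars k))
    fun t _ => inferInstance
  refine ⟨fun j => ?_, T.card * C, fun j => ?_⟩
  · have := (hsup j).1
    exact Submodule.finiteDimensional_of_le (hT j)
  · have := (hsup j).1
    refine (Submodule.finrank_mono (hT j)).trans ((hsup j).2.trans ?_)
    calc _ ≤ ∑ t ∈ T.filter (·.1 ≤ j), C * (j + 1) ^ (d - 1) := by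
          refine Finset.sum_le_sum fun t _ => ?_
          refine (Submodule.finrank_map_le _ _).trans ((hC _).trans ?_)
          gcongr
          omega
      _ ≤ T.card * C * (j + 1) ^ (d - 1) := by
          rw [Finset.sum_const, smul_eq_mul, mul_assoc]
          gcongr
          exact Finset.filter_subset _ _

/-- Homogeneous elements of positive degree are nilpotent modulo a homogeneous ideal of finite
colength. -/
theorem exists_pow_mem_of_finiteDimensional_quotient {I : Ideal R} (hI : I.IsHomogeneous 𝒜)
    [FiniteDimensional k (R ⧸ I)] {e : ℕ} (he : 0 < e) {b : R} (hb : b ∈ 𝒜 e) :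
    ∃ n, b ^ n ∈ I := by
  have : IsArtinianRing (R ⧸ I) := isArtinian_of_tower k inferInstance
  obtain ⟨n, y, hy⟩ := IsArtinian.exists_pow_succ_smul_dvd (Ideal.Quotient.mk I b) (1 : R ⧸ I)
  obtain ⟨c, rfl⟩ := Ideal.Quotient.mk_surjective y
  refine ⟨n, ?_⟩
  have hpow : ∀ m, b ^ m ∈ 𝒜 (m * e) := fun m => by simpa using SetLike.pow_mem_graded m hb
  have hmem : b ^ n - c * b ^ (n + 1) ∈ I := by
    rw [← Ideal.Quotient.eq, map_pow, map_mul, map_pow]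
    simpa [mul_comm] using hy.symm
  have hcomp : gradedProj 𝒜 (n * e) (b ^ n - c * b ^ (n + 1)) ∈ I := hI _ hmem
  have hzero : gradedProj 𝒜 (n * e) (c * b ^ (n + 1)) ∈ (⊥ : Submodule k R) := by
    refine gradedProj_smul_mem 𝒜 𝒜 ⊥ c (b ^ (n + 1)) (n * e) fun i l hil => ?_
    rw [gradedProj_of_mem_ne 𝒜 (hpow (n + 1)), smul_zero]
    · exact zero_mem _
    · intro h
      rw [add_mul] at h
      omega
  rwa [map_sub, (Submodule.mem_bot k).mp hzero, sub_zero, gradedProj_of_mem 𝒜 (hpow n)] at hcomp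

theorem Ideal.IsHomogeneous.frobeniusPow {I : Ideal R} (hI : I.IsHomogeneous 𝒜) (p : ℕ)
    [Fact p.Prime] [CharP R p] (n : ℕ) : (I.frobeniusPow (p ^ n)).IsHomogeneous 𝒜 := by
  have : I.frobeniusPow (p ^ n) =
      Ideal.span ((· ^ p ^ n) '' {x | x ∈ I ∧ SetLike.IsHomogeneousElem 𝒜 x}) := by
    refine le_antisymm (Ideal.span_le.mpr ?_)
      (Ideal.span_mono (Set.image_mono fun x hx => hx.1))
    rintro _ ⟨x, hx, rfl⟩
    obtain ⟨s, hs, -⟩ := exists_finset_sum_gradedProj 𝒜 x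
    have hpow : x ^ p ^ n = ∑ i ∈ s, gradedProj 𝒜 i x ^ p ^ n := by
      rw [← sum_pow_char_pow, hs]
    simp only [SetLike.mem_coe, hpow]
    exact Ideal.sum_mem _ fun i _ => Ideal.subset_span
      ⟨gradedProj 𝒜 i x, ⟨hI i hx, i, gradedProj_mem 𝒜 i x⟩, rfl⟩
  rw [this]
  refine Ideal.homogeneous_span 𝒜 _ ?_
  rintro _ ⟨x, ⟨-, i, hi⟩, rfl⟩
  exact ⟨_, SetLike.pow_mem_graded (p ^ n) hi⟩

/-- The quotients `R ⧸ I^{[q]}` vanish in degrees at least `C * q`. -/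
theorem exists_graded_le_frobeniusPow [Algebra.FiniteType k R]
    (h𝒜0 : 𝒜 0 ≤ Submodule.span k {1}) {I : Ideal R} (hI : I.IsHomogeneous 𝒜)
    [FiniteDimensional k (R ⧸ I)] (p : ℕ) [Fact p.Prime] [CharP R p] :
    ∃ C : ℕ, ∀ n j, C * p ^ n ≤ j → ∀ r ∈ 𝒜 j, r ∈ I.frobeniusPow (p ^ n) := by
  classical
  obtain ⟨S, hS, hdeg⟩ := exists_finset_adjoin_eq_top_of_pos_degree 𝒜 h𝒜0
  have hnil : ∀ x ∈ S, ∃ m, x ^ m ∈ I := fun x hx => by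
    obtain ⟨e, he, hxe⟩ := hdeg x hx
    exact exists_pow_mem_of_finiteDimensional_quotient 𝒜 hI he hxe
  choose! e _ hxe using hdeg
  choose! m hm using hnil
  refine ⟨1 + ∑ x ∈ S, m x * e x, fun n j hj r hr => ?_⟩
  have hq : 0 < p ^ n := pow_pos (Fact.out : p.Prime).pos n
  have hrS : r ∈ Submodule.span k (Submonoid.closure (S : Set R) : Set R) := by
    rw [← Algebra.adjoin_eq_span, hS]
    exact Submodule.mem_top
  suffices h : gradedProj 𝒜 j r ∈ I.frobeniusPow (p ^ n) by
    rwa [gradedProj_of_mem 𝒜 hr] at h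
  clear hr
  induction hrS using Submodule.span_induction with
  | zero =>
    rw [map_zero]
    exact zero_mem _
  | add x y _ _ hx hy =>
    rw [map_add]
    exact add_mem hx hy
  | smul c x _ hx =>
    rw [map_smul, Algebra.smul_def]
    exact Ideal.mul_mem_left _ _ hx
  | mem x hx =>
    obtain ⟨f, -, rfl⟩ := Submonoid.mem_closure_finset.mp hx
    by_cases h : ∃ a ∈ S, m a * p ^ n ≤ f a
    · obtain ⟨a, ha, hle⟩ := h
      refine (hI.frobeniusPow 𝒜 p n) j (Ideal.mem_of_dvd _ (Finset.dvd_prod_of_mem _ ha) ?_)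
      refine Ideal.mem_of_dvd _ (pow_dvd_pow a hle) ?_
      rw [pow_mul]
      exact Ideal.subset_span ⟨_, hm a ha, rfl⟩
    · push Not at h
      have hmem : ∏ a ∈ S, a ^ f a ∈ 𝒜 (∑ a ∈ S, f a * e a) :=
        SetLike.prod_mem_graded 𝒜 (fun a => f a * e a) (fun a => a ^ f a) fun a ha => by
          simpa using SetLike.pow_mem_graded (f a) (hxe a ha)
      rw [gradedProj_of_mem_ne 𝒜 hmem]
      · exact zero_mem _
      · refine ne_of_lt (lt_of_lt_of_le ?_ hj)
        calc ∑ a ∈ S, f a * e a ≤ ∑ a ∈ S, m a * e a * p ^ n :=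
              Finset.sum_le_sum fun a ha => by nlinarith [(h a ha).le]
          _ = (∑ a ∈ S, m a * e a) * p ^ n := by rw [Finset.sum_mul]
          _ < (1 + ∑ a ∈ S, m a * e a) * p ^ n := by nlinarith

/-- The quotients `M ⧸ I^{[q]} M` vanish in degrees at least `C * q`. -/
theorem exists_graded_module_le_frobeniusPow_smul_top [Algebra.FiniteType k R]
    [Module.Finite R M] (h𝒜0 : 𝒜 0 ≤ Submodule.span k {1}) {I : Ideal R}
    (hI : I.IsHomogeneous 𝒜) [FiniteDimensional k (R ⧸ I)] (p : ℕ) [Fact p.Prime] [CharP R p] :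
    ∃ C : ℕ, ∀ n j, C * p ^ n ≤ j →
      ℳ j ≤ (I.frobeniusPow (p ^ n) • (⊤ : Submodule R M)).restrictScalars k := by
  obtain ⟨T, -, hT⟩ := exists_finset_graded_le_sup 𝒜 ℳ
  obtain ⟨C, hC⟩ := exists_graded_le_frobeniusPow 𝒜 h𝒜0 hI p
  refine ⟨C + T.sup Prod.fst, fun n j hj => (hT j).trans (Finset.sup_le fun t ht => ?_)⟩
  have hq : 0 < p ^ n := pow_pos (Fact.out : p.Prime).pos n
  have ht : t.1 ≤ T.sup Prod.fst := Finset.le_sup (f := Prod.fst) (Finset.mem_of_mem_filter t ht)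
  rintro _ ⟨r, hr, rfl⟩
  rw [Submodule.restrictScalars_mem]
  refine Submodule.smul_mem_smul (hC n _ ?_ r hr) Submodule.mem_top
  rw [add_mul] at hj
  have : T.sup Prod.fst ≤ T.sup Prod.fst * p ^ n := Nat.le_mul_of_pos_right _ hq
  omega

end Graded

/-- The dimension of a graded quotient is the sum of the dimensions of its graded pieces. -/
theorem finrank_quotient_eq_sum_gradedPieceLen {k M : Type*} [Field k] [AddCommGroup M]
    [Module k M] (ℳ : ℕ → Submodule k M) [DirectSum.Decomposition ℳ]
    [∀ j, FiniteDimensional k (ℳ j)] {N : Submodule k M}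
    (hN : ∀ m ∈ N, ∀ j, gradedProj ℳ j m ∈ N) {J : ℕ} (hJ : ∀ j, J ≤ j → ℳ j ≤ N) :
    Module.finrank k (M ⧸ N) = ∑ j ∈ Finset.range J, gradedPieceLen k ℳ N j := by
  let φ : M →ₗ[k] ∀ j : Fin J, ↥(ℳ j) ⧸ N.comap (ℳ j).subtype :=
    LinearMap.pi fun j => (N.comap (ℳ j).subtype).mkQ ∘ₗ
      (gradedProj ℳ j).codRestrict (ℳ j) (gradedProj_mem ℳ j)
  have hφ : ∀ m j, φ m j = Submodule.Quotient.mk ⟨gradedProj ℳ j m, gradedProj_mem ℳ j m⟩ :=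
    fun m j => rfl
  have hker : LinearMap.ker φ = N := by
    ext m
    rw [LinearMap.mem_ker]
    constructor
    · intro hm
      obtain ⟨s, hs, -⟩ := exists_finset_sum_gradedProj ℳ m
      rw [← hs]
      refine sum_mem fun j _ => ?_
      by_cases hj : j < J
      · have := congrFun hm ⟨j, hj⟩
        rw [hφ, Pi.zero_apply, Submodule.Quotient.mk_eq_zero] at this
        exact this
      · exact hJ j (not_lt.mp hj) (gradedProj_mem ℳ j m)
    · intro hm
      ext j
      rw [hφ, Pi.zero_apply, Submodule.Quotient.mk_eq_zero]
      exact hN m hm j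
  have hsurj : Function.Surjective φ := by
    intro v
    choose w hw using fun j => Submodule.Quotient.mk_surjective _ (v j)
    refine ⟨∑ j, (w j : M), ?_⟩
    ext j
    rw [hφ, ← hw j]
    congr 2
    rw [map_sum, Finset.sum_eq_single j]
    · exact gradedProj_of_mem ℳ (w j).2
    · intro i _ hij
      exact gradedProj_of_mem_ne ℳ (w i).2 fun h => hij (Fin.ext h)
    · simp
  rw [← (Submodule.quotEquivOfEq _ _ hker).finrank_eq,
    (φ.quotKerEquivOfSurjective hsurj).finrank_eq, Module.finrank_pi_fintype,
    Finset.sum_range]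
  rfl

theorem integral_Ioi_comp_natFloor_mul (G : ℕ → ℝ) {q : ℕ} (hq : 0 < q) {L : ℕ}
    (hG : ∀ m, L ≤ m → G m = 0) :
    ∫ x in Set.Ioi (0 : ℝ), G ⌊x * q⌋₊ = (∑ m ∈ Finset.range L, G m) / q := by
  have hq' : (0 : ℝ) < q := Nat.cast_pos.mpr hq
  have hIco : ∀ (m : ℕ) (x : ℝ), 0 ≤ x →
      (x ∈ Set.Ico ((m : ℝ) / q) ((m + 1 : ℝ) / q) ↔ ⌊x * q⌋₊ = m) := fun m x hx => by
    rw [Nat.floor_eq_iff (by positivity), Set.mem_Ico, div_le_iff₀ hq', lt_div_iff₀ hq']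
  have hsub : ∀ m : ℕ, Set.Ico ((m : ℝ) / q) ((m + 1 : ℝ) / q) ⊆ Set.Ici 0 := fun m x hx =>
    le_trans (by positivity) hx.1
  have heq : ∀ x ∈ Set.Ici (0 : ℝ), G ⌊x * q⌋₊ =
      ∑ m ∈ Finset.range L,
        (Set.Ico ((m : ℝ) / q) ((m + 1 : ℝ) / q)).indicator (fun _ => G m) x := by
    intro x hx
    simp only [Set.indicator_apply, hIco _ x hx, Finset.sum_ite_eq, Finset.mem_range]
    split_ifs with h
    · rfl
    · exact hG _ (not_lt.mp h)
  rw [← integral_Ici_eq_integral_Ioi, setIntegral_congr_fun measurableSet_Ici heq,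
    integral_finsetSum]
  · rw [Finset.sum_div]
    refine Finset.sum_congr rfl fun m _ => ?_
    rw [setIntegral_indicator measurableSet_Ico, Set.inter_eq_self_of_subset_right (hsub m),
      setIntegral_const, measureReal_def, Real.volume_Ico, ← sub_div, add_sub_cancel_left,
      ENNReal.toReal_ofReal (by positivity), smul_eq_mul]
    ring
  · intro m _
    exact ((integrable_indicator_iff measurableSet_Ico).mpr
      (integrableOn_const (by simp))).integrableOn

theorem Finset.sum_range_sum_range_mul_add {α : Type*} [AddCommMonoid α] (f : ℕ → α) (L n : ℕ) :
    ∑ m ∈ Finset.range L, ∑ i ∈ Finset.range n, f (m * n + i) =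
      ∑ j ∈ Finset.range (L * n), f j := by
  induction L with
  | zero => simp
  | succ L ih => rw [Finset.sum_range_succ, ih, Nat.succ_mul, Finset.sum_range_add]

/-- For a graded pair `(R, I)` of dimension `d ≥ 2` and a finitely
generated graded `R`-module `M`, the Hilbert–Kunz multiplicity
`e_HK(M, I) = lim ℓ(M/I^{[q]}M)/q^d` equals `∫₀^∞ f_{M_R, I}(x) dx`. -/
theorem statement2
    (k : Type*) [Field k] [PerfectField k] (p : ℕ) [Fact p.Prime] [CharP k p]
    (R : Type*) [CommRing R] [IsDomain R] [IsNoetherianRing R] [Algebra k R]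
    [Algebra.FiniteType k R]
    (𝒜 : ℕ → Submodule k R) [GradedAlgebra 𝒜]
    (h𝒜0 : 𝒜 0 ≤ Submodule.span k {1})
    (d : ℕ) (hd : 2 ≤ d) (hdim : ringKrullDim R = d)
    (I : Ideal R) (hI : I.IsHomogeneous 𝒜) (hIcolen : FiniteDimensional k (R ⧸ I))
    (n₀ : ℕ) (hn₀pos : 0 < n₀)
    (hn₀dvd : ∀ m, 0 < m → 𝒜 m ≠ ⊥ → n₀ ∣ m)
    (hn₀gcd : ∀ c : ℕ, (∀ m, 0 < m → 𝒜 m ≠ ⊥ → c ∣ m) → c ∣ n₀)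
    (M : Type*) [AddCommGroup M] [Module R M] [Module k M] [IsScalarTower k R M]
    [Module.Finite R M]
    (ℳ : ℕ → Submodule k M) [DirectSum.Decomposition ℳ] [SetLike.GradedSMul 𝒜 ℳ]
    (F : ℝ → ℝ)
    (hF : ∀ x : ℝ, 0 ≤ x → Tendsto (fun n => hkStep k ℳ I d n₀ p n x) atTop (𝓝 (F x))) :
    Tendsto
      (fun n => (Module.finrank k
          (M ⧸ ((I.frobeniusPow (p ^ n)) • (⊤ : Submodule R M)).restrictScalars k) : ℝ)
        / ((p : ℝ) ^ n) ^ d)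
      atTop (𝓝 (∫ x in Set.Ioi (0 : ℝ), F x)) := by
  have : CharP R p := charP_of_injective_algebraMap (algebraMap k R).injective p
  obtain ⟨hfin, C₁, hC₁⟩ := exists_finrank_graded_module_le 𝒜 ℳ h𝒜0 (by omega) hdim
  obtain ⟨C₂, hC₂⟩ := exists_graded_module_le_frobeniusPow_smul_top 𝒜 ℳ h𝒜0 hI p
  have hp : 0 < p := (Fact.out : p.Prime).pos
  have hq : ∀ n, 0 < p ^ n := fun n => pow_pos hp n
  let N : ℕ → Submodule k M := fun n =>
    (I.frobeniusPow (p ^ n) • (⊤ : Submodule R M)).restrictScalars k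
  let ℓ : ℕ → ℕ → ℕ := fun n j => gradedPieceLen k ℳ (N n) j
  let G : ℕ → ℕ → ℝ := fun n m =>
    (∑ i ∈ Finset.range n₀, (ℓ n (m * n₀ + i) : ℝ)) / ((p : ℝ) ^ n) ^ (d - 1)
  have hstep : ∀ n x, hkStep k ℳ I d n₀ p n x = G n ⌊x * (p ^ n : ℕ)⌋₊ := fun _ _ => rfl
  have hℓzero : ∀ n j, C₂ * p ^ n ≤ j → ℓ n j = 0 := fun n j hj => by
    have htop : (N n).comap (ℳ j).subtype = ⊤ := by
      rw [eq_top_iff]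
      exact fun x _ => hC₂ n j hj x.2
    have : Subsingleton (↥(ℳ j) ⧸ (N n).comap (ℳ j).subtype) :=
      Submodule.Quotient.subsingleton_iff.mpr htop
    exact Module.finrank_zero_of_subsingleton
  have hℓle : ∀ n j, ℓ n j ≤ C₁ * (C₂ * p ^ n) ^ (d - 1) := fun n j => by
    rcases le_or_gt (C₂ * p ^ n) j with hj | hj
    · rw [hℓzero n j hj]
      exact Nat.zero_le _
    · exact (Submodule.finrank_quotient_le _).trans ((hC₁ j).trans (by gcongr; exact hj))
  have hGzero : ∀ n m, C₂ * p ^ n ≤ m → G n m = 0 := fun n m hm => by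
    have : ∀ i, ℓ n (m * n₀ + i) = 0 := fun i =>
      hℓzero n _ (hm.trans ((Nat.le_mul_of_pos_right m hn₀pos).trans (Nat.le_add_right _ _)))
    simp [G, this]
  have hGnonneg : ∀ n m, 0 ≤ G n m := fun n m => by positivity
  have hGle : ∀ n m, G n m ≤ n₀ * (C₁ * (C₂ : ℝ) ^ (d - 1)) := fun n m => by
    have hq' : (0 : ℝ) < p ^ n := by exact_mod_cast hq n
    rw [div_le_iff₀ (by positivity)]
    calc ∑ i ∈ Finset.range n₀, (ℓ n (m * n₀ + i) : ℝ)
        ≤ ∑ i ∈ Finset.range n₀, (C₁ : ℝ) * (C₂ * p ^ n) ^ (d - 1) :=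
          Finset.sum_le_sum fun i _ => by exact_mod_cast hℓle n _
      _ = _ := by rw [Finset.sum_const, Finset.card_range, nsmul_eq_mul, mul_pow]; ring
  have hint : ∀ n, ∫ x in Set.Ioi (0 : ℝ), hkStep k ℳ I d n₀ p n x =
      (Module.finrank k (M ⧸ N n) : ℝ) / ((p : ℝ) ^ n) ^ d := fun n => by
    simp only [hstep]
    rw [integral_Ioi_comp_natFloor_mul (G n) (hq n) (hGzero n),
      finrank_quotient_eq_sum_gradedPieceLen ℳ
        (fun m hm j => gradedProj_mem_smul_top 𝒜 ℳ (hI.frobeniusPow 𝒜 p n) hm j)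
        (J := C₂ * p ^ n * n₀)
        (fun j hj => hC₂ n j ((Nat.le_mul_of_pos_right _ hn₀pos).trans hj)),
      ← Finset.sum_range_sum_range_mul_add _ (C₂ * p ^ n) n₀]
    simp only [G]
    rw [← Finset.sum_div, div_div, Nat.cast_pow, ← pow_succ, Nat.sub_add_cancel (by omega)]
    push_cast
    rfl
  refine Tendsto.congr hint (tendsto_integral_of_dominated_convergence
    ((Set.Iio (C₂ : ℝ)).indicator fun _ => n₀ * (C₁ * (C₂ : ℝ) ^ (d - 1))) ?_ ?_ ?_ ?_)
  · intro n
    have hmeas : Measurable fun x : ℝ => ⌊x * (p ^ n : ℕ)⌋₊ :=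
      Nat.measurable_floor.comp (measurable_id.mul_const _)
    exact ((measurable_of_countable (G n)).comp hmeas).aestronglyMeasurable
  · rw [integrable_indicator_iff measurableSet_Iio]
    refine integrableOn_const ?_
    rw [Measure.restrict_apply measurableSet_Iio, Set.inter_comm, Set.Ioi_inter_Iio]
    simp
  · intro n
    refine (ae_restrict_mem measurableSet_Ioi).mono fun x hx => ?_
    rw [hstep, Real.norm_of_nonneg (hGnonneg n _), Set.indicator_apply]
    split_ifs with h
    · exact hGle n _
    · refine (hGzero n _ (Nat.le_floor ?_)).le
      push_cast
      exact mul_le_mul_of_nonneg_right (not_lt.mp h) (by positivity)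
  · exact (ae_restrict_mem measurableSet_Ioi).mono fun x hx => hF x (le_of_lt hx)
end
end
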